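/- arXiv:1103.3086 — 12 statements merged into one kernel-verified Lean document; each statement's English description precedes it below -/
import Mathlib

section
/- Let d ≥ 1, R > 1, q > 0, let p ∈ S^d be a fixed unit vector (the North Pole) and set a = R·p. Define the density η'_{R,q}(y) = 1 + q/R^{d−1} − q(R²−1)/‖y−a‖^{d+1} for y ∈ S^d. Then ∫_{S^d} η'_{R,q}(y) dσ_d(y) = 1, and for every x ∈ S^d, ∫_{S^d} η'_{R,q}(y) ‖x−y‖^{1−d} dσ_d(y) + q‖x−a‖^{1−d} = 1 + q/R^{d−1}. In other words, the measure with density η'_{R,q} with respect to σ_d is the signed equilibrium associated with the external field Q(x) = q/‖x−a‖^{d−1}. -/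
open MeasureTheory

theorem lintegral_rpow_mul_exp_neg_mul_Ioi {a r : ℝ} (ha : 0 < a) (hr : 0 < r) :
    ∫⁻ t in Set.Ioi (0 : ℝ), ENNReal.ofReal (t ^ (a - 1) * Real.exp (-(r * t))) =
      ENNReal.ofReal (r ^ (-a) * Real.Gamma a) := by
  have h := Real.integral_rpow_mul_exp_neg_mul_Ioi ha hr
  rw [one_div, Real.inv_rpow hr.le, ← Real.rpow_neg hr.le] at h
  have hpos : 0 < r ^ (-a) * Real.Gamma a :=
    mul_pos (Real.rpow_pos_of_pos hr _) (Real.Gamma_pos_of_pos ha)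
  rw [← h, ofReal_integral_eq_lintegral_ofReal]
  · exact not_imp_comm.1 integral_undef (by rw [h]; exact hpos.ne')
  · filter_upwards [ae_restrict_mem measurableSet_Ioi] with t ht
    exact mul_nonneg (Real.rpow_nonneg (le_of_lt ht) _) (Real.exp_pos _).le

theorem lintegral_rpow_mul_mul_add_rpow_Ioi {a b X Y : ℝ} (ha : 0 < a) (hb : 0 < b) (hX : 0 < X)
    (hY : 0 < Y) :
    ∫⁻ v in Set.Ioi (0 : ℝ), ENNReal.ofReal (v ^ (a - 1) * (v * X + Y) ^ (-(a + b))) =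
      ENNReal.ofReal
        (X ^ (-a) * Y ^ (-b) * (Real.Gamma a * Real.Gamma b / Real.Gamma (a + b))) := by
  have hΓ : 0 < Real.Gamma (a + b) := Real.Gamma_pos_of_pos (by positivity)
  have hΓ' : ENNReal.ofReal (Real.Gamma (a + b)) ≠ 0 := by simpa using hΓ
  rw [← ENNReal.mul_right_inj hΓ' ENNReal.ofReal_ne_top, ← lintegral_const_mul _ (by fun_prop)]
  calc
    _ = ∫⁻ v in Set.Ioi (0 : ℝ), ∫⁻ s in Set.Ioi (0 : ℝ), ENNReal.ofReal
          (v ^ (a - 1) * (s ^ (a + b - 1) * Real.exp (-((v * X + Y) * s)))) := by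
      refine setLIntegral_congr_fun measurableSet_Ioi fun v hv => ?_
      have hv : 0 < v := hv
      have h := lintegral_rpow_mul_exp_neg_mul_Ioi (a := a + b) (r := v * X + Y) (by positivity)
        (by positivity)
      have hnn : 0 ≤ v ^ (a - 1) := by positivity
      simp_rw [ENNReal.ofReal_mul hnn]
      rw [lintegral_const_mul _ (by fun_prop), h, ENNReal.ofReal_mul (by positivity)]
      ring
    _ = ∫⁻ s in Set.Ioi (0 : ℝ), ∫⁻ v in Set.Ioi (0 : ℝ), ENNReal.ofReal
          (v ^ (a - 1) * (s ^ (a + b - 1) * Real.exp (-((v * X + Y) * s)))) :=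
      lintegral_lintegral_swap (by simp only [Function.uncurry_def]; fun_prop)
    _ = ∫⁻ s in Set.Ioi (0 : ℝ), ENNReal.ofReal (X ^ (-a) * Real.Gamma a) *
          ENNReal.ofReal (s ^ (b - 1) * Real.exp (-(Y * s))) := by
      refine setLIntegral_congr_fun measurableSet_Ioi fun s hs => ?_
      have hs : 0 < s := hs
      have h := lintegral_rpow_mul_exp_neg_mul_Ioi ha (mul_pos hs hX)
      have hnn : 0 ≤ s ^ (a + b - 1) * Real.exp (-(Y * s)) := by positivity
      have hΓa := (Real.Gamma_pos_of_pos ha).le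
      have hre (v : ℝ) : v ^ (a - 1) * (s ^ (a + b - 1) * Real.exp (-((v * X + Y) * s))) =
          (s ^ (a + b - 1) * Real.exp (-(Y * s))) * (v ^ (a - 1) * Real.exp (-(s * X * v))) := by
        rw [show -((v * X + Y) * s) = -(Y * s) + -(s * X * v) by ring, Real.exp_add]
        ring
      simp_rw [hre, ENNReal.ofReal_mul hnn]
      rw [lintegral_const_mul _ (by fun_prop), h, ← ENNReal.ofReal_mul hnn,
        ← ENNReal.ofReal_mul (by positivity), Real.mul_rpow hs.le hX.le,
        show a + b - 1 = a + (b - 1) by ring, Real.rpow_add hs, Real.rpow_neg hs.le]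
      congr 1
      have := (Real.rpow_pos_of_pos hs a).ne'
      field_simp
    _ = _ := by
      have hΓa := (Real.Gamma_pos_of_pos ha).le
      rw [lintegral_const_mul _ (by fun_prop), lintegral_rpow_mul_exp_neg_mul_Ioi hb hY,
        ← ENNReal.ofReal_mul (by positivity), ← ENNReal.ofReal_mul hΓ.le]
      congr 1
      field_simp

theorem integral_sub_integral_eq_intervalIntegral {E : Type*} [MeasurableSpace E]
    [TopologicalSpace E] [T2Space E] [SecondCountableTopology E] [BorelSpace E]
    {μ : Measure E} [IsFiniteMeasure μ] {K : Set E} (hK : IsCompact K) (hμ : μ Kᶜ = 0)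
    {F F' : ℝ → E → ℝ} {a b : ℝ} (hab : a ≤ b)
    (hF : ∀ r ∈ Set.Icc a b, ContinuousOn (F r) K)
    (hF' : ContinuousOn (Function.uncurry F') (Set.Icc a b ×ˢ K))
    (hd : ∀ y ∈ K, ∀ r ∈ Set.Icc a b, HasDerivAt (fun r => F r y) (F' r y) r) :
    (∫ y, F b y ∂μ) - ∫ y, F a y ∂μ = ∫ r in a..b, ∫ y, F' r y ∂μ := by
  have hrestr : μ.restrict K = μ :=
    Measure.restrict_eq_self_of_ae_mem (by rwa [ae_iff])
  have hae : ∀ᵐ y ∂μ, y ∈ K := by rwa [ae_iff]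
  have hint : ∀ r ∈ Set.Icc a b, Integrable (F r) μ := fun r hr => by
    have := (hF r hr).integrableOn_compact (μ := μ) hK
    rwa [IntegrableOn, hrestr] at this
  rw [intervalIntegral_integral_swap,
    ← integral_sub (hint b (by simp [hab])) (hint a (by simp [hab]))]
  · refine integral_congr_ae ?_
    filter_upwards [hae] with y hy
    refine (intervalIntegral.integral_eq_sub_of_hasDerivAt (f := fun r => F r y) ?_ ?_).symm
    · rw [Set.uIcc_of_le hab]
      exact hd y hy
    · refine ContinuousOn.intervalIntegrable ?_
      rw [Set.uIcc_of_le hab]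
      exact hF'.comp (f := fun r => (r, y)) (by fun_prop) fun r hr => ⟨hr, hy⟩
  · have h := hF'.integrableOn_compact (μ := (volume : Measure ℝ).prod μ) (isCompact_Icc.prod hK)
    rw [IntegrableOn, ← Measure.prod_restrict, hrestr] at h
    rw [Set.uIoc_of_le hab]
    exact h.mono_measure
      (Measure.prod_mono (Measure.restrict_mono Set.Ioc_subset_Icc_self le_rfl) le_rfl)

theorem integral_eq_of_integral_deriv_eq_zero {E : Type*} [MeasurableSpace E]
    [TopologicalSpace E] [T2Space E] [SecondCountableTopology E] [BorelSpace E]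
    {μ : Measure E} [IsFiniteMeasure μ] {K : Set E} (hK : IsCompact K) (hμ : μ Kᶜ = 0)
    {F F' : ℝ → E → ℝ} {a b : ℝ} (hab : a ≤ b)
    (hF : ∀ r ∈ Set.Icc a b, ContinuousOn (F r) K)
    (hF' : ContinuousOn (Function.uncurry F') (Set.Icc a b ×ˢ K))
    (hd : ∀ y ∈ K, ∀ r ∈ Set.Icc a b, HasDerivAt (fun r => F r y) (F' r y) r)
    (h0 : ∀ r ∈ Set.Icc a b, ∫ y, F' r y ∂μ = 0) :
    ∫ y, F b y ∂μ = ∫ y, F a y ∂μ := by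
  have h := integral_sub_integral_eq_intervalIntegral hK hμ hab hF hF' hd
  rw [intervalIntegral.integral_congr (g := fun _ => 0)
    (fun r hr => h0 r (by rwa [Set.uIcc_of_le hab] at hr))] at h
  simpa [sub_eq_zero] using h

open scoped RealInnerProductSpace

theorem inner_mem_Icc_of_mem_sphere {V : Type*} [NormedAddCommGroup V]
    [InnerProductSpace ℝ V] {p y : V} (hp : ‖p‖ = 1) (hy : y ∈ Metric.sphere (0 : V) 1) :
    ⟪p, y⟫ ∈ Set.Icc (-1 : ℝ) 1 := by
  have h := abs_real_inner_le_norm p y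
  rw [mem_sphere_zero_iff_norm.1 hy, hp, one_mul] at h
  exact abs_le.1 h

theorem one_add_sq_sub_pos {r t : ℝ} (hr0 : 0 ≤ r) (hr : r < 1) (ht : t ≤ 1) :
    0 < 1 + r ^ 2 - 2 * r * t := by
  nlinarith [sq_pos_of_pos (sub_pos.2 hr)]

theorem hasDerivAt_one_add_sq_sub (r t : ℝ) :
    HasDerivAt (fun r : ℝ => 1 + r ^ 2 - 2 * r * t) (2 * r - 2 * t) r := by
  simpa using ((hasDerivAt_pow 2 r).const_add 1).fun_sub
    (((hasDerivAt_id r).const_mul 2).mul_const t)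

theorem two_sub_two_mul_inner_eq {V : Type*} [NormedAddCommGroup V]
    [InnerProductSpace ℝ V] {x y : V} (hx : ‖x‖ = 1) (hy : ‖y‖ = 1) :
    2 - 2 * ⟪x, y⟫ = ‖x - y‖ ^ 2 := by
  rw [norm_sub_sq_real, hx, hy]
  ring

theorem norm_sub_smul_rpow {V : Type*} [NormedAddCommGroup V] [InnerProductSpace ℝ V] {p y : V}
    (hp : ‖p‖ = 1) (hy : ‖y‖ = 1) {R : ℝ} (hR : 1 < R) (s : ℝ) :
    ‖y - R • p‖ ^ s = R ^ s * (1 + R⁻¹ ^ 2 - 2 * R⁻¹ * ⟪p, y⟫) ^ (s / 2) := by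
  have hR0 : 0 < R := by linarith
  have hpos := one_add_sq_sub_pos (inv_nonneg.2 hR0.le) (inv_lt_one_of_one_lt₀ hR)
    (inner_mem_Icc_of_mem_sphere hp (by simpa using hy)).2
  have hsq : ‖y - R • p‖ ^ 2 = R ^ 2 * (1 + R⁻¹ ^ 2 - 2 * R⁻¹ * ⟪p, y⟫) := by
    rw [norm_sub_sq_real, norm_smul, mul_pow, hp, hy, real_inner_smul_right, real_inner_comm y p,
      Real.norm_eq_abs, sq_abs]
    field_simp
    ring
  have hs (z : ℝ) (hz : 0 ≤ z) : (z ^ 2) ^ (s / 2) = z ^ s := by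
    rw [← Real.rpow_natCast, ← Real.rpow_mul hz]
    congr 1
    push_cast
    ring
  rw [← hs _ (norm_nonneg _), hsq, Real.mul_rpow (by positivity) hpos.le, hs _ hR0.le]

section Sphere

variable {V : Type*} [NormedAddCommGroup V] [InnerProductSpace ℝ V] [FiniteDimensional ℝ V]
  [MeasurableSpace V] [BorelSpace V] {σ : Measure V}

theorem integral_inner_mul_sub_sq_mul_deriv_eq_zero [IsFiniteMeasure σ]
    (hsupp : σ (Metric.sphere (0 : V) 1)ᶜ = 0)
    (hinv : ∀ f : V ≃ₗᵢ[ℝ] V, σ.map f = σ) {p e : V} (hp : ‖p‖ = 1) (he : ‖e‖ = 1)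
    (hpe : ⟪p, e⟫ = 0) {φ φ' : ℝ → ℝ} (hφ : ∀ t ∈ Set.Icc (-1 : ℝ) 1, HasDerivAt φ (φ' t) t)
    (hφ' : ContinuousOn φ' (Set.Icc (-1) 1)) :
    ∫ y, (⟪p, y⟫ * φ ⟪p, y⟫ - ⟪e, y⟫ ^ 2 * φ' ⟪p, y⟫) ∂σ = 0 := by
  set u : ℝ → V := fun θ => Real.cos θ • p + Real.sin θ • e with hu
  have hep : ⟪e, p⟫ = 0 := by rw [real_inner_comm, hpe]
  have hunorm (θ : ℝ) : ‖u θ‖ = 1 := by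
    have : ‖u θ‖ ^ 2 = 1 := by
      rw [← real_inner_self_eq_norm_sq, hu]
      simp only [inner_add_left, inner_add_right, inner_smul_left, inner_smul_right, hpe, hep,
        real_inner_self_eq_norm_sq, hp, he]
      simp
      linarith [Real.sin_sq_add_cos_sq θ]
    nlinarith [norm_nonneg (u θ)]
  set S : ℝ → V ≃ₗᵢ[ℝ] V := fun θ => (Submodule.span ℝ {u θ}).reflection with hS
  have hSapp (θ : ℝ) (y : V) : S θ y = (2 * ⟪u θ, y⟫) • u θ - y := by
    rw [hS]
    simp only [Submodule.reflection_singleton_apply, hunorm]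
    simp [mul_smul, ofNat_smul_eq_nsmul]
  set P : ℝ → V → ℝ := fun θ y => Real.cos (2 * θ) * ⟪p, y⟫ + Real.sin (2 * θ) * ⟪e, y⟫ with hP
  set Q : ℝ → V → ℝ := fun θ y => Real.sin (2 * θ) * ⟪p, y⟫ - Real.cos (2 * θ) * ⟪e, y⟫ with hQ
  have hPS (θ : ℝ) (y : V) : ⟪p, S θ y⟫ = P θ y := by
    rw [hSapp]
    simp only [hu, hP, inner_sub_right, inner_add_left, inner_add_right, inner_smul_left,
      inner_smul_right, hpe, real_inner_self_eq_norm_sq, hp, Real.cos_two_mul, Real.sin_two_mul]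
    simp
    ring
  have hQS (θ : ℝ) (y : V) : ⟪e, S θ y⟫ = Q θ y := by
    rw [hSapp]
    simp only [hu, hQ, inner_sub_right, inner_add_left, inner_add_right, inner_smul_left,
      inner_smul_right, hep, real_inner_self_eq_norm_sq, he, Real.cos_two_mul', Real.sin_two_mul]
    simp
    linear_combination ⟪e, y⟫ * Real.sin_sq_add_cos_sq θ
  have hmem (θ : ℝ) {y : V} (hy : y ∈ Metric.sphere (0 : V) 1) : P θ y ∈ Set.Icc (-1 : ℝ) 1 := by
    rw [← hPS]
    exact inner_mem_Icc_of_mem_sphere hp (by simpa using hy)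
  have hφc : ContinuousOn φ (Set.Icc (-1) 1) :=
    fun t ht => (hφ t ht).continuousAt.continuousWithinAt
  have hcov (θ : ℝ) (g : V → ℝ) : ∫ y, g (S θ y) ∂σ = ∫ y, g y ∂σ :=
    MeasurePreserving.integral_comp ⟨(S θ).continuous.measurable, hinv _⟩
      (S θ).toMeasurableEquiv.measurableEmbedding g
  have key := integral_sub_integral_eq_intervalIntegral (μ := σ) (isCompact_sphere (0 : V) 1) hsupp
    (F := fun θ y => Q θ y * φ (P θ y))
    (F' := fun θ y => 2 * (P θ y * φ (P θ y) - Q θ y ^ 2 * φ' (P θ y)))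
    zero_le_one
    (fun θ _ => by
      have h1 : ContinuousOn (fun y => φ (P θ y)) (Metric.sphere (0 : V) 1) :=
        hφc.comp (f := fun y => P θ y) (by fun_prop) fun y hy => hmem θ hy
      exact ContinuousOn.mul (by fun_prop) h1)
    (by
      have h1 : ContinuousOn (fun z : ℝ × V => φ (P z.1 z.2))
          (Set.Icc 0 1 ×ˢ Metric.sphere (0 : V) 1) :=
        hφc.comp (f := fun z : ℝ × V => P z.1 z.2) (by fun_prop) fun z hz => hmem z.1 hz.2
      have h2 : ContinuousOn (fun z : ℝ × V => φ' (P z.1 z.2))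
          (Set.Icc 0 1 ×ˢ Metric.sphere (0 : V) 1) :=
        hφ'.comp (f := fun z : ℝ × V => P z.1 z.2) (by fun_prop) fun z hz => hmem z.1 hz.2
      exact ContinuousOn.mul continuousOn_const ((ContinuousOn.mul (by fun_prop) h1).sub
        (ContinuousOn.mul (by fun_prop) h2)))
    (fun y hy θ _ => by
      have h2 : HasDerivAt (fun θ : ℝ => 2 * θ) 2 θ := by
        simpa using (hasDerivAt_id θ).const_mul 2
      have hPd : HasDerivAt (fun θ => P θ y) (-2 * Q θ y) θ := by
        refine ((h2.cos.mul_const _).add (h2.sin.mul_const _)).congr_deriv ?_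
        simp only [hQ]; ring
      have hQd : HasDerivAt (fun θ => Q θ y) (2 * P θ y) θ := by
        refine ((h2.sin.mul_const _).sub (h2.cos.mul_const _)).congr_deriv ?_
        simp only [hP]; ring
      refine (hQd.mul ((hφ _ (hmem θ hy)).comp θ hPd)).congr_deriv ?_
      simp only [Function.comp_apply]
      ring)
  simp only [← hPS, ← hQS] at key
  simp_rw [hcov _ fun y => ⟪e, y⟫ * φ ⟪p, y⟫,
    hcov _ fun y => 2 * (⟪p, y⟫ * φ ⟪p, y⟫ - ⟪e, y⟫ ^ 2 * φ' ⟪p, y⟫), integral_const_mul] at key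
  simpa using key.symm

theorem integral_finrank_mul_sub_mul_deriv_eq_zero {d : ℕ} [IsFiniteMeasure σ]
    (hdim : Module.finrank ℝ V = d + 1)
    (hsupp : σ (Metric.sphere (0 : V) 1)ᶜ = 0)
    (hinv : ∀ f : V ≃ₗᵢ[ℝ] V, σ.map f = σ) {p : V} (hp : ‖p‖ = 1)
    {φ φ' : ℝ → ℝ} (hφ : ∀ t ∈ Set.Icc (-1 : ℝ) 1, HasDerivAt φ (φ' t) t)
    (hφ' : ContinuousOn φ' (Set.Icc (-1) 1)) :
    ∫ y, (d * ⟪p, y⟫ * φ ⟪p, y⟫ - (1 - ⟪p, y⟫ ^ 2) * φ' ⟪p, y⟫) ∂σ = 0 := by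
  obtain ⟨b, hb⟩ := Orthonormal.exists_orthonormalBasis_extension_of_card_eq (𝕜 := ℝ) (E := V)
    (ι := Fin (d + 1)) (by simp [hdim]) (v := fun _ => p) (s := {0})
    (by
      rw [orthonormal_iff_ite]
      rintro ⟨i, rfl⟩ ⟨j, rfl⟩
      simp [Set.domRestrict, hp])
  have hb0 : b 0 = p := hb 0 rfl
  have hrestr : σ.restrict (Metric.sphere (0 : V) 1) = σ :=
    Measure.restrict_eq_self_of_ae_mem (by rwa [ae_iff])
  have hφc : ContinuousOn φ (Set.Icc (-1) 1) :=
    fun t ht => (hφ t ht).continuousAt.continuousWithinAt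
  have hterm (i : Fin d) :
      ∫ y, (⟪p, y⟫ * φ ⟪p, y⟫ - ⟪b i.succ, y⟫ ^ 2 * φ' ⟪p, y⟫) ∂σ = 0 :=
    integral_inner_mul_sub_sq_mul_deriv_eq_zero hsupp hinv hp (b.norm_eq_one _)
      (by rw [← hb0]; exact b.inner_eq_zero (Fin.succ_ne_zero i).symm) hφ hφ'
  have hint (i : Fin d) :
      Integrable (fun y => ⟪p, y⟫ * φ ⟪p, y⟫ - ⟪b i.succ, y⟫ ^ 2 * φ' ⟪p, y⟫) σ := by
    rw [← hrestr]
    refine ContinuousOn.integrableOn_compact (isCompact_sphere _ _) ?_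
    have h1 : ContinuousOn (fun y : V => φ ⟪p, y⟫) (Metric.sphere (0 : V) 1) :=
      hφc.comp (f := fun y => ⟪p, y⟫) (by fun_prop) fun y hy => inner_mem_Icc_of_mem_sphere hp hy
    have h2 : ContinuousOn (fun y : V => φ' ⟪p, y⟫) (Metric.sphere (0 : V) 1) :=
      hφ'.comp (f := fun y => ⟪p, y⟫) (by fun_prop) fun y hy => inner_mem_Icc_of_mem_sphere hp hy
    exact (ContinuousOn.mul (by fun_prop) h1).sub (ContinuousOn.mul (by fun_prop) h2)
  calc
    _ = ∫ y, ∑ i : Fin d, (⟪p, y⟫ * φ ⟪p, y⟫ - ⟪b i.succ, y⟫ ^ 2 * φ' ⟪p, y⟫) ∂σ := by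
      refine integral_congr_ae ?_
      have hae : ∀ᵐ y ∂σ, y ∈ Metric.sphere (0 : V) 1 := by rwa [ae_iff]
      filter_upwards [hae] with y hy
      have h := b.sum_sq_norm_inner_right y
      simp only [Real.norm_eq_abs, sq_abs, Fin.sum_univ_succ, hb0,
        mem_sphere_zero_iff_norm.1 hy] at h
      have hmul := Finset.sum_mul Finset.univ (fun i : Fin d => ⟪b i.succ, y⟫ ^ 2) (φ' ⟪p, y⟫)
      rw [Finset.sum_sub_distrib, Finset.sum_const, Finset.card_univ,
        Fintype.card_fin, nsmul_eq_mul]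
      linear_combination φ' ⟪p, y⟫ * h - hmul
    _ = 0 := by
      rw [integral_finsetSum _ fun i _ => hint i]
      simp [hterm]

theorem integral_sub_mul_inner_rpow {d : ℕ} [IsProbabilityMeasure σ]
    (hdim : Module.finrank ℝ V = d + 1) (hsupp : σ (Metric.sphere (0 : V) 1)ᶜ = 0)
    (hinv : ∀ f : V ≃ₗᵢ[ℝ] V, σ.map f = σ) {p : V} (hp : ‖p‖ = 1)
    {C g : ℝ} (hg : 0 ≤ g) (hgC : g < C) :
    ∫ y, (C - g * ⟪p, y⟫) ^ (-(d : ℝ)) ∂σ = (C ^ 2 - g ^ 2) ^ (-(d : ℝ) / 2) := by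
  have hC : 0 < C := hg.trans_lt hgC
  have hpos {y : V} (hy : y ∈ Metric.sphere (0 : V) 1) {r : ℝ} (hr : r ∈ Set.Icc 0 g) :
      0 < C - r * ⟪p, y⟫ := by
    nlinarith [(inner_mem_Icc_of_mem_sphere hp hy).2, hr.1, hr.2]
  have hpos' {r : ℝ} (hr : r ∈ Set.Icc 0 g) : 0 < C ^ 2 - r ^ 2 := by
    nlinarith [hr.1, hr.2.trans_lt hgC]
  have key := integral_eq_of_integral_deriv_eq_zero (μ := σ) (isCompact_sphere (0 : V) 1) hsupp
    (F := fun r y => (C - r * ⟪p, y⟫) ^ (-(d : ℝ)) * (C ^ 2 - r ^ 2) ^ ((d : ℝ) / 2))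
    (F' := fun r y => d * (C ^ 2 - r ^ 2) ^ ((d : ℝ) / 2 - 1) * C *
      ((C * ⟪p, y⟫ - r) * (C - r * ⟪p, y⟫) ^ (-(d : ℝ) - 1))) hg
    (fun r hr => by
      refine ContinuousOn.mul (ContinuousOn.rpow_const (by fun_prop) fun y hy => ?_)
        continuousOn_const
      exact Or.inl (hpos hy hr).ne')
    (by
      refine ContinuousOn.mul (ContinuousOn.mul (ContinuousOn.mul continuousOn_const
        (ContinuousOn.rpow_const (by fun_prop) ?_)) continuousOn_const)
        (ContinuousOn.mul (by fun_prop) (ContinuousOn.rpow_const (by fun_prop) ?_))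
      · exact fun z hz => Or.inl (hpos' hz.1).ne'
      · exact fun z hz => Or.inl (hpos hz.2 hz.1).ne')
    (fun y hy r hr => by
      have h1 : HasDerivAt (fun r : ℝ => C - r * ⟪p, y⟫) (-⟪p, y⟫) r := by
        simpa using ((hasDerivAt_id r).mul_const ⟪p, y⟫).const_sub C
      have h2 : HasDerivAt (fun r : ℝ => C ^ 2 - r ^ 2) (-(2 * r)) r := by
        simpa using (hasDerivAt_pow 2 r).const_sub (C ^ 2)
      refine ((h1.rpow_const (p := -(d : ℝ)) (Or.inl (hpos hy hr).ne')).mul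
        (h2.rpow_const (p := (d : ℝ) / 2) (Or.inl (hpos' hr).ne'))).congr_deriv ?_
      have e1 := Real.rpow_add_one (hpos hy hr).ne' (-(d : ℝ) - 1)
      have e2 := Real.rpow_add_one (hpos' hr).ne' ((d : ℝ) / 2 - 1)
      rw [sub_add_cancel] at e1 e2
      rw [e1, e2]
      ring)
    (fun r hr => by
      rw [integral_const_mul]
      have hposI {t : ℝ} (ht : t ∈ Set.Icc (-1 : ℝ) 1) : 0 < C - r * t := by
        nlinarith [hr.1, hr.2, ht.2]
      have h := integral_finrank_mul_sub_mul_deriv_eq_zero hdim hsupp hinv hp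
        (φ := fun t => (C - r * t) ^ (-(d : ℝ)))
        (φ' := fun t => d * r * (C - r * t) ^ (-(d : ℝ) - 1))
        (fun t ht => by
          have h1 : HasDerivAt (fun t : ℝ => C - r * t) (-r) t := by
            simpa using ((hasDerivAt_id t).const_mul r).const_sub C
          refine (h1.rpow_const (p := -(d : ℝ)) (Or.inl (hposI ht).ne')).congr_deriv ?_
          ring)
        (ContinuousOn.mul continuousOn_const (ContinuousOn.rpow_const (by fun_prop)
          fun t ht => Or.inl (hposI ht).ne'))
      rcases Nat.eq_zero_or_pos d with rfl | hd
      · simp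
      have hd' : (d : ℝ) ≠ 0 := by positivity
      suffices h' : d * ∫ y, (C * ⟪p, y⟫ - r) * (C - r * ⟪p, y⟫) ^ (-(d : ℝ) - 1) ∂σ = 0 by
        rw [(mul_eq_zero.1 h').resolve_left hd', mul_zero]
      rw [← integral_const_mul, ← h]
      refine integral_congr_ae ?_
      have hae : ∀ᵐ y ∂σ, y ∈ Metric.sphere (0 : V) 1 := by rwa [ae_iff]
      filter_upwards [hae] with y hy
      have e1 := Real.rpow_add_one (hpos hy hr).ne' (-(d : ℝ) - 1)
      rw [sub_add_cancel] at e1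
      simp only [e1]
      ring)
  have hg' := hpos' (r := g) (by simp [hg])
  have h0 : C ^ (-(d : ℝ)) * (C ^ 2) ^ ((d : ℝ) / 2) = 1 := by
    rw [← Real.rpow_natCast C 2, ← Real.rpow_mul hC.le, ← Real.rpow_add hC]
    simp [mul_div_cancel₀]
  rw [integral_mul_const] at key
  simp only [zero_mul, sub_zero, ne_eq, OfNat.ofNat_ne_zero, not_false_eq_true, zero_pow, h0,
    integral_const, probReal_univ, smul_eq_mul, mul_one] at key
  rw [neg_div, Real.rpow_neg hg'.le]
  exact eq_inv_of_mul_eq_one_left key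

theorem integral_sub_inner_mul_rpow_eq_zero {d : ℕ} [IsFiniteMeasure σ] (hd : 1 ≤ d)
    (hdim : Module.finrank ℝ V = d + 1) (hsupp : σ (Metric.sphere (0 : V) 1)ᶜ = 0)
    (hinv : ∀ f : V ≃ₗᵢ[ℝ] V, σ.map f = σ) {p : V} (hp : ‖p‖ = 1)
    {ρ : ℝ} (hρ0 : 0 ≤ ρ) (hρ : ρ < 1) :
    ∫ y, (ρ - ⟪p, y⟫) * (1 + ρ ^ 2 - 2 * ρ * ⟪p, y⟫) ^ (-((d : ℝ) + 1) / 2) ∂σ = 0 := by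
  obtain ⟨m, rfl⟩ := Nat.exists_eq_add_of_le' hd
  have hIcc {y : V} (hy : y ∈ Metric.sphere (0 : V) 1) := inner_mem_Icc_of_mem_sphere hp hy
  have hposI {r t : ℝ} (hr : r ∈ Set.Icc 0 ρ) (ht : t ∈ Set.Icc (-1 : ℝ) 1) :
      0 < 1 + r ^ 2 - 2 * r * t := one_add_sq_sub_pos hr.1 (hr.2.trans_lt hρ) ht.2
  set k : ℝ := -(((m + 1 : ℕ) : ℝ) + 1) / 2 with hk
  have hk' : (m : ℝ) = -2 * k - 2 := by rw [hk]; push_cast; ring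
  have hae : ∀ᵐ y ∂σ, y ∈ Metric.sphere (0 : V) 1 := by rwa [ae_iff]
  have geg {r : ℝ} (hr : r ∈ Set.Icc 0 ρ) := integral_finrank_mul_sub_mul_deriv_eq_zero hdim hsupp
    hinv hp (φ := fun t => (1 + r ^ 2 - 2 * r * t) ^ k)
    (φ' := fun t => -(2 * r) * k * (1 + r ^ 2 - 2 * r * t) ^ (k - 1))
    (fun t ht => by
      have h1 : HasDerivAt (fun t : ℝ => 1 + r ^ 2 - 2 * r * t) (-(2 * r)) t := by
        simpa using ((hasDerivAt_id t).const_mul (2 * r)).const_sub (1 + r ^ 2)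
      exact h1.rpow_const (Or.inl (hposI hr ht).ne'))
    (ContinuousOn.mul continuousOn_const (ContinuousOn.rpow_const (by fun_prop)
      fun t ht => Or.inl (hposI hr ht).ne'))
  rcases hρ0.eq_or_lt with rfl | hρ0'
  · have h := geg (r := 0) (by simp)
    simp only [ne_eq, OfNat.ofNat_ne_zero, not_false_eq_true, zero_pow, add_zero, mul_zero,
      zero_mul, sub_zero, Real.one_rpow, mul_one, neg_zero] at h
    rw [integral_const_mul] at h
    have h2 := (mul_eq_zero.1 h).resolve_left (by positivity)
    simp [integral_neg, h2]
  have key := integral_eq_of_integral_deriv_eq_zero (μ := σ) (isCompact_sphere (0 : V) 1) hsupp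
    (F := fun r y => r ^ (m + 1) * ((r - ⟪p, y⟫) * (1 + r ^ 2 - 2 * r * ⟪p, y⟫) ^ k))
    (F' := fun r y => -r ^ m * (((m + 1 : ℕ) : ℝ) * ⟪p, y⟫ * (1 + r ^ 2 - 2 * r * ⟪p, y⟫) ^ k -
      (1 - ⟪p, y⟫ ^ 2) * (-(2 * r) * k * (1 + r ^ 2 - 2 * r * ⟪p, y⟫) ^ (k - 1)))) hρ0
    (fun r hr => by
      refine ContinuousOn.mul (by fun_prop) (ContinuousOn.mul (by fun_prop)
        (ContinuousOn.rpow_const (by fun_prop) fun y hy => ?_))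
      exact Or.inl (hposI hr (hIcc hy)).ne')
    (by
      refine ContinuousOn.mul (by fun_prop) (ContinuousOn.sub (ContinuousOn.mul (by fun_prop)
        (ContinuousOn.rpow_const (by fun_prop) ?_)) (ContinuousOn.mul (by fun_prop)
          (ContinuousOn.mul (by fun_prop) (ContinuousOn.rpow_const (by fun_prop) ?_))))
      all_goals exact fun z hz => Or.inl (hposI hz.1 (hIcc hz.2)).ne')
    (fun y hy r hr => by
      have h1 := hasDerivAt_one_add_sq_sub r ⟪p, y⟫
      have h2 : HasDerivAt (fun r : ℝ => r - ⟪p, y⟫) 1 r := (hasDerivAt_id r).sub_const _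
      have hp0 := (hposI hr (hIcc hy)).ne'
      refine ((hasDerivAt_pow (m + 1) r).mul
        (h2.mul (h1.rpow_const (p := k) (Or.inl hp0)))).congr_deriv ?_
      have e1 := Real.rpow_add_one hp0 (k - 1)
      rw [sub_add_cancel] at e1
      rw [e1]
      simp only [Nat.add_sub_cancel, Pi.mul_apply]
      rw [e1]
      push_cast
      rw [hk']
      ring)
    (fun r hr => by rw [integral_const_mul, geg hr, mul_zero])
  rw [integral_const_mul] at key
  simpa [hρ0'.ne'] using key

theorem integral_newton_inside {d : ℕ} [IsProbabilityMeasure σ] (hd : 1 ≤ d)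
    (hdim : Module.finrank ℝ V = d + 1) (hsupp : σ (Metric.sphere (0 : V) 1)ᶜ = 0)
    (hinv : ∀ f : V ≃ₗᵢ[ℝ] V, σ.map f = σ) {p : V} (hp : ‖p‖ = 1)
    {ρ : ℝ} (hρ0 : 0 ≤ ρ) (hρ : ρ < 1) :
    ∫ y, (1 + ρ ^ 2 - 2 * ρ * ⟪p, y⟫) ^ (-((d : ℝ) - 1) / 2) ∂σ = 1 := by
  have hIcc {y : V} (hy : y ∈ Metric.sphere (0 : V) 1) := inner_mem_Icc_of_mem_sphere hp hy
  have hposI {r t : ℝ} (hr : r ∈ Set.Icc 0 ρ) (ht : t ∈ Set.Icc (-1 : ℝ) 1) :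
      0 < 1 + r ^ 2 - 2 * r * t := one_add_sq_sub_pos hr.1 (hr.2.trans_lt hρ) ht.2
  have key := integral_eq_of_integral_deriv_eq_zero (μ := σ) (isCompact_sphere (0 : V) 1) hsupp
    (F := fun r y => (1 + r ^ 2 - 2 * r * ⟪p, y⟫) ^ (-((d : ℝ) - 1) / 2))
    (F' := fun r y => -((d : ℝ) - 1) *
      ((r - ⟪p, y⟫) * (1 + r ^ 2 - 2 * r * ⟪p, y⟫) ^ (-((d : ℝ) + 1) / 2))) hρ0
    (fun r hr => by
      refine ContinuousOn.rpow_const (by fun_prop) fun y hy => ?_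
      exact Or.inl (hposI hr (hIcc hy)).ne')
    (by
      refine ContinuousOn.mul (by fun_prop) (ContinuousOn.mul (by fun_prop)
        (ContinuousOn.rpow_const (by fun_prop) ?_))
      exact fun z hz => Or.inl (hposI hz.1 (hIcc hz.2)).ne')
    (fun y hy r hr => by
      have h1 := hasDerivAt_one_add_sq_sub r ⟪p, y⟫
      refine (h1.rpow_const (p := -((d : ℝ) - 1) / 2)
        (Or.inl (hposI hr (hIcc hy)).ne')).congr_deriv ?_
      rw [show -((d : ℝ) - 1) / 2 - 1 = -((d : ℝ) + 1) / 2 by ring]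
      ring)
    (fun r hr => by
      rw [integral_const_mul, integral_sub_inner_mul_rpow_eq_zero hd hdim hsupp hinv hp hr.1
        (hr.2.trans_lt hρ), mul_zero])
  simpa using key

theorem integral_poissonKernel {d : ℕ} [IsProbabilityMeasure σ] (hd : 1 ≤ d)
    (hdim : Module.finrank ℝ V = d + 1) (hsupp : σ (Metric.sphere (0 : V) 1)ᶜ = 0)
    (hinv : ∀ f : V ≃ₗᵢ[ℝ] V, σ.map f = σ) {p : V} (hp : ‖p‖ = 1)
    {ρ : ℝ} (hρ0 : 0 ≤ ρ) (hρ : ρ < 1) :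
    Integrable (fun y => (1 + ρ ^ 2 - 2 * ρ * ⟪p, y⟫) ^ (-((d : ℝ) + 1) / 2)) σ ∧
    ∫ y, (1 + ρ ^ 2 - 2 * ρ * ⟪p, y⟫) ^ (-((d : ℝ) + 1) / 2) ∂σ = (1 - ρ ^ 2)⁻¹ := by
  have hae : ∀ᵐ y ∂σ, y ∈ Metric.sphere (0 : V) 1 := by rwa [ae_iff]
  have hrestr : σ.restrict (Metric.sphere (0 : V) 1) = σ := Measure.restrict_eq_self_of_ae_mem hae
  have hpos {y : V} (hy : y ∈ Metric.sphere (0 : V) 1) : 0 < 1 + ρ ^ 2 - 2 * ρ * ⟪p, y⟫ :=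
    one_add_sq_sub_pos hρ0 hρ (inner_mem_Icc_of_mem_sphere hp hy).2
  have hcont (s : ℝ) : ContinuousOn (fun y => (1 + ρ ^ 2 - 2 * ρ * ⟪p, y⟫) ^ s)
      (Metric.sphere (0 : V) 1) :=
    ContinuousOn.rpow_const (by fun_prop) fun y hy => Or.inl (hpos hy).ne'
  have hint {f : V → ℝ} (hf : ContinuousOn f (Metric.sphere (0 : V) 1)) : Integrable f σ := by
    rw [← hrestr]
    exact hf.integrableOn_compact (isCompact_sphere _ _)
  refine ⟨hint (hcont _), ?_⟩
  have h1 : 1 - ρ ^ 2 ≠ 0 := by nlinarith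
  refine eq_inv_of_mul_eq_one_right ?_
  rw [← integral_const_mul]
  calc
    _ = ∫ y, ((1 + ρ ^ 2 - 2 * ρ * ⟪p, y⟫) ^ (-((d : ℝ) - 1) / 2) - 2 * ρ *
          ((ρ - ⟪p, y⟫) * (1 + ρ ^ 2 - 2 * ρ * ⟪p, y⟫) ^ (-((d : ℝ) + 1) / 2))) ∂σ := by
      refine integral_congr_ae ?_
      filter_upwards [hae] with y hy
      have e1 := Real.rpow_add_one (hpos hy).ne' (-((d : ℝ) + 1) / 2)
      rw [show -((d : ℝ) + 1) / 2 + 1 = -((d : ℝ) - 1) / 2 by ring] at e1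
      rw [e1]
      ring
    _ = 1 := by
      have h2 := hint (f := fun y => 2 * ρ *
          ((ρ - ⟪p, y⟫) * (1 + ρ ^ 2 - 2 * ρ * ⟪p, y⟫) ^ (-((d : ℝ) + 1) / 2)))
        (ContinuousOn.mul (by fun_prop) (ContinuousOn.mul (by fun_prop) (hcont _)))
      rw [integral_sub (hint (hcont _)) h2,
        integral_const_mul, integral_newton_inside hd hdim hsupp hinv hp hρ0 hρ,
        integral_sub_inner_mul_rpow_eq_zero hd hdim hsupp hinv hp hρ0 hρ]
      simp

theorem lintegral_sub_inner_rpow {d : ℕ} [IsProbabilityMeasure σ]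
    (hdim : Module.finrank ℝ V = d + 1) (hsupp : σ (Metric.sphere (0 : V) 1)ᶜ = 0)
    (hinv : ∀ f : V ≃ₗᵢ[ℝ] V, σ.map f = σ) {p : V} (hp : ‖p‖ = 1) {C : ℝ} {w : V}
    (hw : ‖w‖ < C) :
    ∫⁻ y, ENNReal.ofReal ((C - ⟪w, y⟫) ^ (-(d : ℝ))) ∂σ =
      ENNReal.ofReal ((C ^ 2 - ‖w‖ ^ 2) ^ (-(d : ℝ) / 2)) := by
  obtain ⟨u, hu, hwu⟩ : ∃ u : V, ‖u‖ = 1 ∧ w = ‖w‖ • u := by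
    rcases eq_or_ne w 0 with rfl | h0
    · exact ⟨p, hp, by simp⟩
    · exact ⟨‖w‖⁻¹ • w, by simp [norm_smul, h0], by simp [smul_smul, h0]⟩
  have hin (y : V) : ⟪w, y⟫ = ‖w‖ * ⟪u, y⟫ := by
    conv_lhs => rw [hwu, real_inner_smul_left]
  have hae : ∀ᵐ y ∂σ, y ∈ Metric.sphere (0 : V) 1 := by rwa [ae_iff]
  have hpos {y : V} (hy : y ∈ Metric.sphere (0 : V) 1) : 0 < C - ‖w‖ * ⟪u, y⟫ := by
    nlinarith [(inner_mem_Icc_of_mem_sphere hu hy).2, norm_nonneg w]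
  simp_rw [hin]
  rw [← integral_sub_mul_inner_rpow hdim hsupp hinv hu (norm_nonneg w) hw,
    ofReal_integral_eq_lintegral_ofReal]
  · rw [← Measure.restrict_eq_self_of_ae_mem hae]
    exact ContinuousOn.integrableOn_compact (isCompact_sphere _ _)
      (ContinuousOn.rpow_const (by fun_prop) fun y hy => Or.inl (hpos hy).ne')
  · filter_upwards [hae] with y hy using Real.rpow_nonneg (hpos hy).le _

theorem measure_singleton_eq_zero_of_mem_sphere {d : ℕ} [IsProbabilityMeasure σ] (hd : 1 ≤ d)
    (hdim : Module.finrank ℝ V = d + 1) (hsupp : σ (Metric.sphere (0 : V) 1)ᶜ = 0)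
    (hinv : ∀ f : V ≃ₗᵢ[ℝ] V, σ.map f = σ) {x : V} (hx : ‖x‖ = 1) : σ {x} = 0 := by
  have hae : ∀ᵐ y ∂σ, y ∈ Metric.sphere (0 : V) 1 := by rwa [ae_iff]
  have hle (ε : ℝ) (hε : 0 < ε) (hε1 : ε ≤ 1) : σ.real {x} ≤ ε := by
    obtain ⟨hint, hval⟩ := integral_poissonKernel hd hdim hsupp hinv hx
      (ρ := 1 - ε) (by linarith) (by linarith)
    have h := setIntegral_le_integral (s := {x}) hint (by
      filter_upwards [hae] with y hy using Real.rpow_nonneg (one_add_sq_sub_pos (by linarith)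
        (by linarith) (inner_mem_Icc_of_mem_sphere hx hy).2).le _)
    rw [hval, integral_singleton, real_inner_self_eq_norm_sq, hx, smul_eq_mul,
      show 1 + (1 - ε) ^ 2 - 2 * (1 - ε) * 1 ^ 2 = ε ^ 2 by ring, ← Real.rpow_natCast ε 2,
      ← Real.rpow_mul hε.le, show ((2 : ℕ) : ℝ) * (-((d : ℝ) + 1) / 2) = -((d + 1 : ℕ) : ℝ) by
        push_cast; ring, Real.rpow_neg hε.le, Real.rpow_natCast, ← div_eq_mul_inv, ← one_div,
      div_le_div_iff₀ (by positivity) (by nlinarith)] at h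
    have h1 : ε ^ (d + 1) ≤ ε ^ 2 := pow_le_pow_of_le_one hε.le hε1 (by omega)
    have h2 : σ.real {x} * ε ≤ ε * ε := by
      nlinarith [measureReal_nonneg (μ := σ) (s := {x}), mul_nonneg (mul_nonneg
        (measureReal_nonneg (μ := σ) (s := {x})) hε.le) (sub_nonneg.2 hε1)]
    exact le_of_mul_le_mul_right h2 hε
  rw [← measureReal_eq_zero_iff]
  refine le_antisymm (le_of_forall_pos_le_add fun ε hε => ?_) measureReal_nonneg
  rw [zero_add]
  exact (hle (min ε 1) (by positivity) (min_le_right _ _)).trans (min_le_left _ _)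

theorem lintegral_poissonKernel_mul_newton {d : ℕ} [IsProbabilityMeasure σ] (hd : 2 ≤ d)
    (hdim : Module.finrank ℝ V = d + 1) (hsupp : σ (Metric.sphere (0 : V) 1)ᶜ = 0)
    (hinv : ∀ f : V ≃ₗᵢ[ℝ] V, σ.map f = σ) {p x : V} (hp : ‖p‖ = 1) (hx : ‖x‖ = 1)
    {r : ℝ} (hr0 : 0 ≤ r) (hr : r < 1) :
    ∫⁻ y, ENNReal.ofReal ((1 + r ^ 2 - 2 * r * ⟪p, y⟫) ^ (-((d : ℝ) + 1) / 2) *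
        (2 - 2 * ⟪x, y⟫) ^ (-((d : ℝ) - 1) / 2)) ∂σ =
      ENNReal.ofReal ((1 - r ^ 2)⁻¹ * (1 + r ^ 2 - 2 * r * ⟪p, x⟫) ^ (-((d : ℝ) - 1) / 2)) := by
  have hd' : (2 : ℝ) ≤ d := by exact_mod_cast hd
  obtain ⟨a, ha⟩ : ∃ a : ℝ, a = ((d : ℝ) + 1) / 2 := ⟨_, rfl⟩
  obtain ⟨b, hb⟩ : ∃ b : ℝ, b = ((d : ℝ) - 1) / 2 := ⟨_, rfl⟩
  have ha0 : 0 < a := by linarith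
  have hb0 : 0 < b := by linarith
  have hab : a + b = d := by linarith
  rw [show -((d : ℝ) + 1) / 2 = -a by linarith, show -((d : ℝ) - 1) / 2 = -b by linarith]
  have hxs : x ∈ Metric.sphere (0 : V) 1 := by simpa using hx
  have hX {y : V} (hy : y ∈ Metric.sphere (0 : V) 1) : 0 < 1 + r ^ 2 - 2 * r * ⟪p, y⟫ :=
    one_add_sq_sub_pos hr0 hr (inner_mem_Icc_of_mem_sphere hp hy).2
  set D := 1 + r ^ 2 - 2 * r * ⟪p, x⟫ with hD
  have hD0 : 0 < D := hX hxs
  have hm : 0 < 1 - r ^ 2 := by nlinarith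
  have hΓa := Real.Gamma_pos_of_pos ha0
  have hΓb := Real.Gamma_pos_of_pos hb0
  have hΓd := Real.Gamma_pos_of_pos (s := (d : ℝ)) (by linarith)
  have hΓd2 := Real.Gamma_pos_of_pos (s := (d : ℝ) / 2) (by linarith)
  have hae : ∀ᵐ y ∂σ, y ∈ Metric.sphere (0 : V) 1 := by rwa [ae_iff]
  have hne : ∀ᵐ y ∂σ, y ≠ x := by
    rw [ae_iff]
    simpa using measure_singleton_eq_zero_of_mem_sphere (by omega) hdim hsupp hinv hx
  have hc0 : 0 < Real.Gamma a * Real.Gamma b / Real.Gamma d := by positivity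
  have hc : ENNReal.ofReal (Real.Gamma a * Real.Gamma b / Real.Gamma d) ≠ 0 := by
    rw [ne_eq, ENNReal.ofReal_eq_zero, not_le]; exact hc0
  rw [← ENNReal.mul_left_inj hc ENNReal.ofReal_ne_top, ← lintegral_mul_const _ (by fun_prop)]
  calc
    _ = ∫⁻ y, (∫⁻ v in Set.Ioi (0 : ℝ), ENNReal.ofReal (v ^ (a - 1) *
          (v * (1 + r ^ 2 - 2 * r * ⟪p, y⟫) + (2 - 2 * ⟪x, y⟫)) ^ (-(d : ℝ)))) ∂σ := by
      refine lintegral_congr_ae ?_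
      filter_upwards [hae, hne] with y hy hyx
      have hY : 0 < 2 - 2 * ⟪x, y⟫ := by
        rw [two_sub_two_mul_inner_eq hx (by simpa using hy)]
        have := norm_pos_iff.2 (sub_ne_zero.2 hyx.symm)
        positivity
      have h := lintegral_rpow_mul_mul_add_rpow_Ioi ha0 hb0 (hX hy) hY
      rw [hab] at h
      rw [h, ENNReal.ofReal_mul (mul_nonneg (Real.rpow_nonneg (hX hy).le _)
        (Real.rpow_nonneg hY.le _))]
    _ = ∫⁻ v in Set.Ioi (0 : ℝ), (∫⁻ y, ENNReal.ofReal (v ^ (a - 1) *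
          (v * (1 + r ^ 2 - 2 * r * ⟪p, y⟫) + (2 - 2 * ⟪x, y⟫)) ^ (-(d : ℝ))) ∂σ) :=
      lintegral_lintegral_swap (by simp only [Function.uncurry_def]; fun_prop)
    _ = ∫⁻ v in Set.Ioi (0 : ℝ), ENNReal.ofReal (v ^ ((1 / 2 : ℝ) - 1) *
          (v * (1 - r ^ 2) ^ 2 + 4 * D) ^ (-(1 / 2 + b))) := by
      refine setLIntegral_congr_fun measurableSet_Ioi fun v hv => ?_
      have hv : 0 < v := hv
      have hnn : 0 ≤ v ^ (a - 1) := by positivity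
      have hw2 : ‖(2 * v * r) • p + (2 : ℝ) • x‖ ^ 2 =
          (v * (1 + r ^ 2) + 2) ^ 2 - v * (v * (1 - r ^ 2) ^ 2 + 4 * D) := by
        rw [norm_add_sq_real, norm_smul, norm_smul, mul_pow, mul_pow, hp, hx,
          real_inner_smul_left, real_inner_smul_right, Real.norm_eq_abs, Real.norm_eq_abs,
          sq_abs, sq_abs, hD]
        ring
      have hw : ‖(2 * v * r) • p + (2 : ℝ) • x‖ < v * (1 + r ^ 2) + 2 := by
        refine lt_of_pow_lt_pow_left₀ 2 (by positivity) ?_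
        rw [hw2]
        have : 0 < v * (v * (1 - r ^ 2) ^ 2 + 4 * D) := by positivity
        linarith
      have h := lintegral_sub_inner_rpow hdim hsupp hinv hp hw
      have hre (y : V) : v * (1 + r ^ 2 - 2 * r * ⟪p, y⟫) + (2 - 2 * ⟪x, y⟫) =
          v * (1 + r ^ 2) + 2 - ⟪(2 * v * r) • p + (2 : ℝ) • x, y⟫ := by
        rw [inner_add_left, real_inner_smul_left, real_inner_smul_left]
        ring
      simp_rw [hre, ENNReal.ofReal_mul hnn]
      rw [lintegral_const_mul _ (by fun_prop), h, hw2, sub_sub_cancel, ← ENNReal.ofReal_mul hnn,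
        Real.mul_rpow hv.le (by positivity), ← mul_assoc, ← Real.rpow_add hv,
        show a - 1 + -(d : ℝ) / 2 = 1 / 2 - 1 by linarith,
        show -(d : ℝ) / 2 = -(1 / 2 + b) by linarith]
    _ = _ := by
      rw [lintegral_rpow_mul_mul_add_rpow_Ioi (by norm_num) hb0 (by positivity) (by positivity),
        ← ENNReal.ofReal_mul (by positivity), Real.Gamma_one_half_eq,
        show 1 / 2 + b = (d : ℝ) / 2 by linarith]
      congr 1
      have hdup := Real.Gamma_mul_Gamma_add_half ((d : ℝ) / 2)
      rw [show (d : ℝ) / 2 + 1 / 2 = a by linarith, show 2 * ((d : ℝ) / 2) = d by ring] at hdup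
      have h4 : (4 : ℝ) ^ (-b) = 2 ^ (1 - (d : ℝ)) := by
        rw [show (4 : ℝ) = 2 ^ (2 : ℝ) by norm_num, ← Real.rpow_mul (by norm_num)]
        congr 1
        linarith
      have hm2 : ((1 - r ^ 2) ^ 2) ^ (-(1 / 2) : ℝ) = (1 - r ^ 2)⁻¹ := by
        rw [← Real.rpow_natCast, ← Real.rpow_mul hm.le]
        norm_num [Real.rpow_neg_one]
      rw [hm2, Real.mul_rpow (by norm_num) hD0.le, h4]
      field_simp
      linear_combination (-1) * hdup

theorem integral_poissonKernel_mul_newton {d : ℕ} [IsProbabilityMeasure σ] (hd : 1 ≤ d)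
    (hdim : Module.finrank ℝ V = d + 1) (hsupp : σ (Metric.sphere (0 : V) 1)ᶜ = 0)
    (hinv : ∀ f : V ≃ₗᵢ[ℝ] V, σ.map f = σ) {p x : V} (hp : ‖p‖ = 1) (hx : ‖x‖ = 1)
    {r : ℝ} (hr0 : 0 ≤ r) (hr : r < 1) :
    Integrable (fun y => (1 + r ^ 2 - 2 * r * ⟪p, y⟫) ^ (-((d : ℝ) + 1) / 2) *
        (2 - 2 * ⟪x, y⟫) ^ (-((d : ℝ) - 1) / 2)) σ ∧
    ∫ y, (1 + r ^ 2 - 2 * r * ⟪p, y⟫) ^ (-((d : ℝ) + 1) / 2) *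
        (2 - 2 * ⟪x, y⟫) ^ (-((d : ℝ) - 1) / 2) ∂σ =
      (1 - r ^ 2)⁻¹ * (1 + r ^ 2 - 2 * r * ⟪p, x⟫) ^ (-((d : ℝ) - 1) / 2) := by
  rcases hd.eq_or_lt with rfl | hd2
  · simpa using integral_poissonKernel le_rfl hdim hsupp hinv hp hr0 hr
  have h := lintegral_poissonKernel_mul_newton hd2 hdim hsupp hinv hp hx hr0 hr
  have hX {y : V} (hy : y ∈ Metric.sphere (0 : V) 1) : 0 < 1 + r ^ 2 - 2 * r * ⟪p, y⟫ :=
    one_add_sq_sub_pos hr0 hr (inner_mem_Icc_of_mem_sphere hp hy).2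
  have hae : ∀ᵐ y ∂σ, y ∈ Metric.sphere (0 : V) 1 := by rwa [ae_iff]
  have hnn : 0 ≤ᵐ[σ] fun y => (1 + r ^ 2 - 2 * r * ⟪p, y⟫) ^ (-((d : ℝ) + 1) / 2) *
      (2 - 2 * ⟪x, y⟫) ^ (-((d : ℝ) - 1) / 2) := by
    filter_upwards [hae] with y hy
    refine mul_nonneg (Real.rpow_nonneg (hX hy).le _) (Real.rpow_nonneg ?_ _)
    rw [two_sub_two_mul_inner_eq hx (by simpa using hy)]
    positivity
  have hm : AEStronglyMeasurable (fun y => (1 + r ^ 2 - 2 * r * ⟪p, y⟫) ^ (-((d : ℝ) + 1) / 2) *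
      (2 - 2 * ⟪x, y⟫) ^ (-((d : ℝ) - 1) / 2)) σ :=
    Measurable.aestronglyMeasurable (by fun_prop)
  refine ⟨⟨hm, ?_⟩, ?_⟩
  · rw [hasFiniteIntegral_iff_ofReal hnn, h]
    exact ENNReal.ofReal_lt_top
  · rw [integral_eq_lintegral_of_nonneg_ae hnn hm, h, ENNReal.toReal_ofReal]
    have h1 : 0 < 1 - r ^ 2 := by nlinarith
    have h2 := hX (y := x) (by simpa using hx)
    positivity

end Sphere

/-- For the external field `Q(x) = q/‖x−a‖^{d−1}` generated by a point
charge `q > 0` at `a = R·p` (`R > 1`, `p` a unit vector), the measure with density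
`η'_{R,q}(y) = 1 + q/R^{d−1} − q(R²−1)/‖y−a‖^{d+1}` with respect to the normalized
surface area measure `σ` on `S^d` has total mass `1` and constant weighted potential
`1 + q/R^{d−1}` on `S^d`; i.e. it is the signed equilibrium associated with `Q`. -/
theorem signed_equilibrium_density (d : ℕ) (hd : 1 ≤ d) (R q : ℝ) (hR : 1 < R) (hq : 0 < q)
    (σ : Measure (EuclideanSpace ℝ (Fin (d + 1)))) [IsProbabilityMeasure σ]
    (hsupp : σ (Metric.sphere (0 : EuclideanSpace ℝ (Fin (d + 1))) 1)ᶜ = 0)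
    (hinv : ∀ f : EuclideanSpace ℝ (Fin (d + 1)) ≃ₗᵢ[ℝ] EuclideanSpace ℝ (Fin (d + 1)),
      Measure.map f σ = σ)
    (p : EuclideanSpace ℝ (Fin (d + 1))) (hp : ‖p‖ = 1) :
    (∫ y, (1 + q / R ^ (d - 1) - q * (R ^ 2 - 1) / ‖y - R • p‖ ^ (d + 1)) ∂σ = 1) ∧
    (∀ x ∈ Metric.sphere (0 : EuclideanSpace ℝ (Fin (d + 1))) 1,
      (∫ y, (1 + q / R ^ (d - 1) - q * (R ^ 2 - 1) / ‖y - R • p‖ ^ (d + 1)) *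
          ‖x - y‖ ^ ((1 : ℝ) - d) ∂σ) + q * ‖x - R • p‖ ^ ((1 : ℝ) - d)
        = 1 + q / R ^ (d - 1)) := by
  have hR0 : 0 < R := by linarith
  have hr0 : 0 ≤ R⁻¹ := by positivity
  have hr1 : R⁻¹ < 1 := inv_lt_one_of_one_lt₀ hR
  have hm : 1 - R⁻¹ ^ 2 ≠ 0 := by nlinarith
  have hdim : Module.finrank ℝ (EuclideanSpace ℝ (Fin (d + 1))) = d + 1 := by simp
  have hae : ∀ᵐ y ∂σ, y ∈ Metric.sphere (0 : EuclideanSpace ℝ (Fin (d + 1))) 1 := by rwa [ae_iff]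
  have hRd : R ^ (1 - (d : ℝ)) = (R ^ (d - 1))⁻¹ := by
    rw [← neg_sub, Real.rpow_neg hR0.le, ← Nat.cast_one, ← Nat.cast_sub hd, Real.rpow_natCast]
  set κ := q / R ^ (d - 1) with hκ
  have hdens {y : EuclideanSpace ℝ (Fin (d + 1))} (hy : ‖y‖ = 1) :
      q * (R ^ 2 - 1) / ‖y - R • p‖ ^ (d + 1) = κ * (1 - R⁻¹ ^ 2) *
        (1 + R⁻¹ ^ 2 - 2 * R⁻¹ * inner ℝ p y) ^ (-((d : ℝ) + 1) / 2) := by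
    have hpow : R ^ (d + 1) = R ^ (d - 1) * R ^ 2 := by
      rw [← pow_add]
      congr 1
      omega
    rw [div_eq_mul_inv, ← Real.rpow_natCast ‖y - R • p‖, ← Real.rpow_neg (norm_nonneg _),
      norm_sub_smul_rpow hp hy hR, Real.rpow_neg hR0.le, Real.rpow_natCast, hpow, hκ]
    push_cast
    field_simp
  obtain ⟨hPint, hPval⟩ := integral_poissonKernel hd hdim hsupp hinv hp hr0 hr1
  constructor
  · calc
      _ = ∫ y, (1 + κ - κ * (1 - R⁻¹ ^ 2) *
            (1 + R⁻¹ ^ 2 - 2 * R⁻¹ * inner ℝ p y) ^ (-((d : ℝ) + 1) / 2)) ∂σ := by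
        refine integral_congr_ae ?_
        filter_upwards [hae] with y hy
        rw [hdens (by simpa using hy)]
      _ = 1 := by
        rw [integral_sub (integrable_const _) (hPint.const_mul _), integral_const_mul, hPval,
          mul_assoc, mul_inv_cancel₀ hm]
        simp
  · intro x hx
    have hx1 : ‖x‖ = 1 := by simpa using hx
    obtain ⟨hCint, hCval⟩ :=
      integral_poissonKernel_mul_newton hd hdim hsupp hinv hp hx1 hr0 hr1
    obtain ⟨hNint, hNval⟩ :=
      integral_poissonKernel_mul_newton hd hdim hsupp hinv hp hx1 le_rfl zero_lt_one
    simp only [ne_eq, OfNat.ofNat_ne_zero, not_false_eq_true, zero_pow, add_zero, mul_zero,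
      zero_mul, sub_zero, Real.one_rpow, one_mul, inv_one] at hNint hNval
    have hint : ∫ y, (1 + κ - q * (R ^ 2 - 1) / ‖y - R • p‖ ^ (d + 1)) *
        ‖x - y‖ ^ ((1 : ℝ) - d) ∂σ = 1 + κ -
          κ * (1 + R⁻¹ ^ 2 - 2 * R⁻¹ * inner ℝ p x) ^ (-((d : ℝ) - 1) / 2) := by
      calc
        _ = ∫ y, ((1 + κ) * (2 - 2 * inner ℝ x y) ^ (-((d : ℝ) - 1) / 2) -
              κ * (1 - R⁻¹ ^ 2) *
              ((1 + R⁻¹ ^ 2 - 2 * R⁻¹ * inner ℝ p y) ^ (-((d : ℝ) + 1) / 2) *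
                (2 - 2 * inner ℝ x y) ^ (-((d : ℝ) - 1) / 2))) ∂σ := by
          refine integral_congr_ae ?_
          filter_upwards [hae] with y hy
          have hy1 : ‖y‖ = 1 := by simpa using hy
          rw [hdens hy1, two_sub_two_mul_inner_eq hx1 hy1, ← Real.rpow_natCast ‖x - y‖,
            ← Real.rpow_mul (norm_nonneg _),
            show ((2 : ℕ) : ℝ) * (-((d : ℝ) - 1) / 2) = 1 - d by push_cast; ring]
          ring
        _ = _ := by
          rw [integral_sub (hNint.const_mul _) (hCint.const_mul _), integral_const_mul,
            integral_const_mul, hNval, hCval, mul_assoc κ,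
            mul_inv_cancel_left₀ hm, mul_one]
    rw [hint, norm_sub_smul_rpow hp hx1 hR, hRd,
      show (1 - (d : ℝ)) / 2 = -((d : ℝ) - 1) / 2 by ring, hκ]
    ring
end

section
/- Let d ≥ 2 and let Q be a continuous function on the unit sphere S^d ⊂ ℝ^{d+1}. Suppose η₁ and η₂ are finite signed Borel measures supported on S^d with η₁(S^d) = η₂(S^d) = 1, whose Newtonian potentials V^{η_i}(x) = ∫ ‖x−y‖^{1−d} dη_i(y) are finite for all x ∈ S^d, and suppose there are constants F₁, F₂ with V^{η₁}(x) + Q(x) = F₁ and V^{η₂}(x) + Q(x) = F₂ for all x ∈ S^d. Then η₁ = η₂ (and F₁ = F₂). -/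
open MeasureTheory

/-- A Gaussian energy is the Gaussian-weighted `L²` norm of the Fourier transform. -/
theorem gaussian_energy_eq {E : Type*} [NormedAddCommGroup E] [InnerProductSpace ℝ E]
    [FiniteDimensional ℝ E] [MeasurableSpace E] [BorelSpace E]
    {m : Measure E} [SFinite m] {f : E → ℝ} (hf : Integrable f m) {b : ℝ} (hb : 0 < b) :
    ∫ v : E, Real.exp (-b * ‖v‖ ^ 2) *
        ‖∫ x, (f x : ℂ) * Complex.exp (inner ℝ x v * Complex.I) ∂m‖ ^ 2 =
      (Real.pi / b) ^ (Module.finrank ℝ E / 2 : ℝ) *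
        ∫ p : E × E, Real.exp (-(‖p.1 - p.2‖ ^ 2 / (4 * b))) * (f p.1 * f p.2) ∂(m.prod m) := by
  have hbc : 0 < (b : ℂ).re := by simpa using hb
  have hG : Integrable (fun v : E => Complex.exp (-b * ‖v‖ ^ 2)) := by
    simpa using GaussianFourier.integrable_cexp_neg_mul_sq_norm_add hbc 0 (0 : E)
  have hff : Integrable (fun p : E × E => (f p.1 : ℂ) * (f p.2 : ℂ)) (m.prod m) :=
    hf.ofReal.mul_prod hf.ofReal
  have hint : Integrable (Function.uncurry fun (v : E) (p : E × E) =>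
      (Complex.exp (-b * ‖v‖ ^ 2) * ((f p.1 : ℂ) * (f p.2 : ℂ))) *
        Complex.exp ((inner ℝ (p.1 - p.2) v : ℝ) * Complex.I)) (volume.prod (m.prod m)) := by
    refine Integrable.mul_bdd (c := 1) (hG.mul_prod hff) ?_ (ae_of_all _ fun q => ?_)
    · exact (by fun_prop : Continuous fun q : E × E × E =>
        Complex.exp ((inner ℝ (q.2.1 - q.2.2) q.1 : ℝ) * Complex.I)).aestronglyMeasurable
    · exact (Complex.norm_exp_ofReal_mul_I _).le
  rw [← Complex.ofReal_inj, ← integral_complex_ofReal]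
  push_cast
  calc ∫ v : E, Complex.exp (-b * ‖v‖ ^ 2) *
        (‖∫ x, (f x : ℂ) * Complex.exp (inner ℝ x v * Complex.I) ∂m‖ : ℂ) ^ 2
      = ∫ v : E, ∫ p : E × E, (Complex.exp (-b * ‖v‖ ^ 2) * ((f p.1 : ℂ) * (f p.2 : ℂ))) *
        Complex.exp ((inner ℝ (p.1 - p.2) v : ℝ) * Complex.I) ∂(m.prod m) := by
        refine integral_congr_ae (ae_of_all _ fun v => ?_)
        dsimp only
        rw [← Complex.mul_conj', ← integral_conj, ← integral_prod_mul, ← integral_const_mul]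
        refine integral_congr_ae (ae_of_all _ fun p => ?_)
        simp only [map_mul, Complex.conj_ofReal, ← Complex.exp_conj, Complex.conj_I]
        rw [inner_sub_left, Complex.ofReal_sub, sub_mul, sub_eq_add_neg, Complex.exp_add, mul_neg]
        ring
    _ = ∫ p : E × E, (∫ v : E, (Complex.exp (-b * ‖v‖ ^ 2) * ((f p.1 : ℂ) * (f p.2 : ℂ))) *
        Complex.exp ((inner ℝ (p.1 - p.2) v : ℝ) * Complex.I)) ∂(m.prod m) :=
        integral_integral_swap hint
    _ = _ := by
        rw [← integral_complex_ofReal, ← integral_const_mul]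
        refine integral_congr_ae (ae_of_all _ fun p => ?_)
        have h := GaussianFourier.integral_cexp_neg_mul_sq_norm_add hbc Complex.I (p.1 - p.2)
        calc ∫ v : E, (Complex.exp (-b * ‖v‖ ^ 2) * ((f p.1 : ℂ) * (f p.2 : ℂ))) *
              Complex.exp ((inner ℝ (p.1 - p.2) v : ℝ) * Complex.I)
            = ∫ v : E, ((f p.1 : ℂ) * (f p.2 : ℂ)) * Complex.exp (-b * ‖v‖ ^ 2 +
                Complex.I * (inner ℝ (p.1 - p.2) v : ℝ)) := by
              refine integral_congr_ae (ae_of_all _ fun v => ?_)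
              dsimp only
              rw [Complex.exp_add, mul_comm Complex.I]
              ring
          _ = _ := by
              rw [integral_const_mul, h]
              push_cast
              rw [Complex.ofReal_cpow (by positivity)]
              push_cast
              rw [Complex.I_sq]
              ring_nf

theorem gaussian_energy_nonneg {E : Type*} [NormedAddCommGroup E] [InnerProductSpace ℝ E]
    [FiniteDimensional ℝ E] [MeasurableSpace E] [BorelSpace E]
    {m : Measure E} [SFinite m] {f : E → ℝ} (hf : Integrable f m) {t : ℝ} (ht : 0 < t) :
    0 ≤ ∫ p : E × E, Real.exp (-(‖p.1 - p.2‖ ^ 2 * t)) * (f p.1 * f p.2) ∂(m.prod m) := by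
  have h := gaussian_energy_eq hf (b := 1 / (4 * t)) (by positivity)
  have h4 : ∀ s : ℝ, s / (4 * (1 / (4 * t))) = s * t := fun s => by field_simp
  simp only [h4] at h
  refine nonneg_of_mul_nonneg_right (a := (Real.pi / (1 / (4 * t))) ^ (Module.finrank ℝ E / 2 : ℝ))
    ?_ (by positivity)
  rw [← h]
  positivity

/-- Strict positive definiteness of the Gaussian kernel. -/
theorem ae_eq_zero_of_gaussian_energy_eq_zero {E : Type*} [NormedAddCommGroup E]
    [InnerProductSpace ℝ E] [FiniteDimensional ℝ E] [MeasurableSpace E] [BorelSpace E]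
    {m : Measure E} [SFinite m] {f : E → ℝ} (hf : Integrable f m) {t : ℝ} (ht : 0 < t)
    (h0 : ∫ p : E × E, Real.exp (-(‖p.1 - p.2‖ ^ 2 * t)) * (f p.1 * f p.2) ∂(m.prod m) = 0) :
    f =ᵐ[m] 0 := by
  have h := gaussian_energy_eq hf (b := 1 / (4 * t)) (by positivity)
  have h4 : ∀ s : ℝ, s / (4 * (1 / (4 * t))) = s * t := fun s => by field_simp
  simp only [h4, h0, mul_zero] at h
  set F : E → ℂ := fun v => ∫ x, (f x : ℂ) * Complex.exp (inner ℝ x v * Complex.I) ∂m with hF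
  have hmeas : ∀ v, AEStronglyMeasurable
      (fun x : E => (f x : ℂ) * Complex.exp (inner ℝ x v * Complex.I)) m := fun v =>
    hf.ofReal.aestronglyMeasurable.mul (by fun_prop : Continuous fun x : E =>
      Complex.exp (inner ℝ x v * Complex.I)).aestronglyMeasurable
  have hFle : ∀ v, ‖F v‖ ≤ ∫ x, ‖f x‖ ∂m := fun v => by
    refine (norm_integral_le_integral_norm _).trans_eq ?_
    simp [Complex.norm_exp_ofReal_mul_I]
  have hFc : Continuous F := by
    refine continuous_of_dominated hmeas (bound := fun x => ‖f x‖)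
      (fun v => ae_of_all _ fun x => ?_) hf.norm (ae_of_all _ fun x => by fun_prop)
    simp [Complex.norm_exp_ofReal_mul_I]
  have hG : Integrable (fun v : E => Real.exp (-(1 / (4 * t)) * ‖v‖ ^ 2)) := by
    have := (GaussianFourier.integrable_cexp_neg_mul_sq_norm_add
      (b := ((1 / (4 * t) : ℝ) : ℂ)) (by rw [Complex.ofReal_re]; positivity) 0 (0 : E)).norm
    simpa [Complex.norm_exp, ← Complex.ofReal_pow, -Complex.ofReal_mul, -Complex.ofReal_inv,
      -Complex.ofReal_div, ← Complex.ofReal_mul, ← Complex.ofReal_inv, ← Complex.ofReal_neg,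
      -Complex.ofReal_neg] using this
  have hF0 : F = 0 := by
    have hGF : Integrable fun v : E => Real.exp (-(1 / (4 * t)) * ‖v‖ ^ 2) * ‖F v‖ ^ 2 :=
      hG.mul_bdd (c := (∫ x, ‖f x‖ ∂m) ^ 2) (hFc.norm.pow 2).aestronglyMeasurable
        (ae_of_all _ fun v => by
          rw [norm_pow, norm_norm]
          gcongr
          exact hFle v)
    have hae := (integral_eq_zero_iff_of_nonneg
      (fun v => mul_nonneg (Real.exp_pos _).le (sq_nonneg _)) hGF).1 h
    rw [← Continuous.ae_eq_iff_eq (volume : Measure E) hFc continuous_zero]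
    filter_upwards [hae] with v hv
    simpa [Real.exp_ne_zero] using hv
  have hint : ∀ (s : E → ℝ), Integrable s m → ∀ v, Integrable
      (fun x : E => (s x : ℂ) * Complex.exp (inner ℝ x v * Complex.I)) m := fun s hs v =>
    hs.ofReal.mul_bdd (c := 1) (by fun_prop : Continuous fun x : E =>
      Complex.exp (inner ℝ x v * Complex.I)).aestronglyMeasurable
      (ae_of_all _ fun x => (Complex.norm_exp_ofReal_mul_I _).le)
  have hchar : ∀ s : E → ℝ, Integrable s m → ∀ v,
      charFun (m.withDensity fun x => ENNReal.ofReal (s x)) v =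
        ∫ x, ((max (s x) 0 : ℝ) : ℂ) * Complex.exp (inner ℝ x v * Complex.I) ∂m := fun s hs v => by
    rw [charFun_apply, integral_withDensity_eq_integral_toReal_smul₀
      hs.aestronglyMeasurable.aemeasurable.ennreal_ofReal (ae_of_all _ fun _ => by simp)]
    simp [ENNReal.toReal_ofReal', Complex.real_smul]
  have hfin : ∀ s : E → ℝ, Integrable s m → ∫⁻ x, ENNReal.ofReal (s x) ∂m ≠ ⊤ := fun s hs =>
    (lintegral_ofReal_le_lintegral_enorm s).trans_lt hs.2 |>.ne
  have := isFiniteMeasure_withDensity (hfin f hf)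
  have := isFiniteMeasure_withDensity (hfin (-f) hf.neg)
  have heq : (m.withDensity fun x => ENNReal.ofReal (f x)) =
      m.withDensity fun x => ENNReal.ofReal ((-f) x) := by
    refine Measure.ext_of_charFun (funext fun v => ?_)
    rw [hchar f hf, hchar (-f) hf.neg, ← sub_eq_zero,
      ← integral_sub (hint _ hf.pos_part v) (hint _ hf.neg.pos_part v)]
    refine Eq.trans ?_ (congrFun hF0 v)
    refine integral_congr_ae (ae_of_all _ fun x => ?_)
    dsimp only
    rw [← sub_mul, ← Complex.ofReal_sub, Pi.neg_apply, max_zero_sub_eq_self]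
  rw [withDensity_eq_iff hf.aestronglyMeasurable.aemeasurable.ennreal_ofReal
    hf.neg.aestronglyMeasurable.aemeasurable.ennreal_ofReal (hfin f hf)] at heq
  filter_upwards [heq] with x hx
  have := congrArg ENNReal.toReal hx
  rw [ENNReal.toReal_ofReal', ENNReal.toReal_ofReal', ← sub_eq_zero, Pi.neg_apply,
    max_zero_sub_eq_self] at this
  exact this

/-- Strict positive definiteness of the Riesz kernel, for densities of finite energy. -/
theorem ae_eq_zero_of_riesz_energy_eq_zero {E : Type*} [NormedAddCommGroup E]
    [InnerProductSpace ℝ E] [FiniteDimensional ℝ E] [MeasurableSpace E] [BorelSpace E]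
    {m : Measure E} [SFinite m] {f : E → ℝ} (hf : Integrable f m) {s : ℝ} (hs : 0 < s)
    (hdiag : ∀ᵐ p ∂(m.prod m), p.1 ≠ p.2)
    (hint : Integrable (fun p : E × E => ‖p.1 - p.2‖ ^ (-s) * (f p.1 * f p.2)) (m.prod m))
    (h0 : ∫ p : E × E, ‖p.1 - p.2‖ ^ (-s) * (f p.1 * f p.2) ∂(m.prod m) = 0) :
    f =ᵐ[m] 0 := by
  have hs2 : 0 < s / 2 := by positivity
  have hΓ := Real.Gamma_pos_of_pos hs2
  have hff : Integrable (fun p : E × E => f p.1 * f p.2) (m.prod m) := hf.mul_prod hf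
  have hgamma : ∀ p : E × E, p.1 ≠ p.2 →
      ∫ t in Set.Ioi (0 : ℝ), t ^ (s / 2 - 1) * Real.exp (-(‖p.1 - p.2‖ ^ 2 * t)) =
        ‖p.1 - p.2‖ ^ (-s) * Real.Gamma (s / 2) := fun p hp => by
    have hr : 0 < ‖p.1 - p.2‖ := norm_pos_iff.2 (sub_ne_zero.2 hp)
    rw [Real.integral_rpow_mul_exp_neg_mul_Ioi hs2 (by positivity), one_div,
      ← Real.rpow_natCast, ← Real.rpow_neg hr.le, ← Real.rpow_mul hr.le]
    congr 2
    push_cast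
    ring
  have hgint : ∀ p : E × E, p.1 ≠ p.2 → Integrable (fun t : ℝ =>
      t ^ (s / 2 - 1) * Real.exp (-(‖p.1 - p.2‖ ^ 2 * t))) (volume.restrict (Set.Ioi 0)) :=
    fun p hp => by
      have hr : 0 < ‖p.1 - p.2‖ := norm_pos_iff.2 (sub_ne_zero.2 hp)
      refine Integrable.of_integral_ne_zero ?_
      rw [hgamma p hp]
      positivity
  set H : E × E → ℝ → ℝ := fun p t =>
    t ^ (s / 2 - 1) * Real.exp (-(‖p.1 - p.2‖ ^ 2 * t)) * (f p.1 * f p.2) with hH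
  have hHm : AEStronglyMeasurable (Function.uncurry H)
      ((m.prod m).prod (volume.restrict (Set.Ioi 0))) := by
    refine AEStronglyMeasurable.mul ?_ hff.aestronglyMeasurable.comp_fst
    exact (by fun_prop : Measurable fun q : (E × E) × ℝ =>
      q.2 ^ (s / 2 - 1) * Real.exp (-(‖q.1.1 - q.1.2‖ ^ 2 * q.2))).aestronglyMeasurable
  have hHint : Integrable (Function.uncurry H)
      ((m.prod m).prod (volume.restrict (Set.Ioi 0))) := by
    rw [integrable_prod_iff hHm]
    refine ⟨?_, ?_⟩
    · filter_upwards [hdiag] with p hp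
      exact (hgint p hp).mul_const (f p.1 * f p.2)
    · refine (hint.norm.mul_const (Real.Gamma (s / 2))).congr ?_
      filter_upwards [hdiag] with p hp
      have : ∀ t ∈ Set.Ioi (0 : ℝ), ‖Function.uncurry H (p, t)‖ =
          t ^ (s / 2 - 1) * Real.exp (-(‖p.1 - p.2‖ ^ 2 * t)) * ‖f p.1 * f p.2‖ := fun t ht => by
        have ht' : 0 < t := ht
        simp only [Function.uncurry_apply_pair, hH]
        rw [norm_mul, Real.norm_of_nonneg (by positivity)]
      rw [setIntegral_congr_fun measurableSet_Ioi this, integral_mul_const, hgamma p hp, norm_mul,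
        Real.norm_of_nonneg (by positivity : 0 ≤ ‖p.1 - p.2‖ ^ (-s))]
      ring
  have hJ : ∀ t, ∫ p, H p t ∂(m.prod m) = t ^ (s / 2 - 1) *
      ∫ p : E × E, Real.exp (-(‖p.1 - p.2‖ ^ 2 * t)) * (f p.1 * f p.2) ∂(m.prod m) := fun t => by
    rw [← integral_const_mul]
    exact integral_congr_ae (ae_of_all _ fun p => mul_assoc _ _ _)
  have hzero : ∫ t in Set.Ioi (0 : ℝ), ∫ p, H p t ∂(m.prod m) = 0 := by
    rw [← integral_integral_swap hHint]
    have : ∀ᵐ p ∂(m.prod m), ∫ t in Set.Ioi (0 : ℝ), H p t =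
        ‖p.1 - p.2‖ ^ (-s) * (f p.1 * f p.2) * Real.Gamma (s / 2) := by
      filter_upwards [hdiag] with p hp
      rw [integral_mul_const, hgamma p hp]
      ring
    rw [integral_congr_ae this, integral_mul_const, h0, zero_mul]
  have hae := (setIntegral_eq_zero_iff_of_nonneg_ae (ae_restrict_of_forall_mem measurableSet_Ioi
    fun t ht => by
      have ht' : 0 < t := ht
      change 0 ≤ ∫ p, H p t ∂(m.prod m)
      rw [hJ]
      exact mul_nonneg (by positivity) (gaussian_energy_nonneg hf ht')) hHint.integral_prod_right).1
    hzero
  have : (ae (volume.restrict (Set.Ioi (0 : ℝ)))).NeBot := by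
    rw [ae_neBot, Ne, Measure.restrict_eq_zero]
    simp
  obtain ⟨t, ht, ht0⟩ := (hae.and (ae_restrict_mem measurableSet_Ioi)).exists
  have ht' : 0 < t := ht0
  replace ht : ∫ p, H p t ∂(m.prod m) = 0 := ht
  rw [hJ] at ht
  exact ae_eq_zero_of_gaussian_energy_eq_zero hf ht'
    ((mul_eq_zero.1 ht).resolve_left (by positivity))

/-- Two vectors of the same norm are exchanged by a linear isometry. -/
theorem exists_swap_isometry {E : Type*} [NormedAddCommGroup E] [InnerProductSpace ℝ E] {y z : E}
    (h : ‖y‖ = ‖z‖) : ∃ L : E ≃ₗᵢ[ℝ] E, L y = z ∧ L z = y := by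
  have hy := Submodule.reflection_sub h
  exact ⟨(ℝ ∙ (y - z))ᗮ.reflection, hy, ((Submodule.reflection_involutive _).eq_iff.1 hy).symm⟩

/-- A multiple of the surface measure on the unit sphere: the image of Lebesgue measure on the
unit ball under radial projection. -/
noncomputable def sphereMeasure (E : Type*) [NormedAddCommGroup E] [InnerProductSpace ℝ E]
    [FiniteDimensional ℝ E] [MeasurableSpace E] [BorelSpace E] : Measure E :=
  (volume.restrict (Metric.ball (0 : E) 1)).map fun u => ‖u‖⁻¹ • u

section sphereMeasure

variable {E : Type*} [NormedAddCommGroup E] [InnerProductSpace ℝ E]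
    [FiniteDimensional ℝ E] [MeasurableSpace E] [BorelSpace E]

theorem measurable_radialProjection : Measurable fun u : E => ‖u‖⁻¹ • u := by fun_prop

instance isFiniteMeasure_sphereMeasure : IsFiniteMeasure (sphereMeasure E) := by
  have : IsFiniteMeasure (volume.restrict (Metric.ball (0 : E) 1)) :=
    ⟨by simpa using measure_ball_lt_top⟩
  exact Measure.isFiniteMeasure_map _ _

theorem ae_sphereMeasure_mem_sphere [Nontrivial E] :
    ∀ᵐ x ∂sphereMeasure E, x ∈ Metric.sphere (0 : E) 1 := by
  refine (ae_map_iff measurable_radialProjection.aemeasurable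
    (Metric.isClosed_sphere (x := (0 : E)) (ε := 1)).measurableSet).2 ?_
  have h : ∀ᵐ u : E, u ≠ 0 := by simp [ae_iff]
  filter_upwards [ae_restrict_of_ae h] with u hu
  simp [norm_smul, hu]

theorem measurePreserving_sphereMeasure (L : E ≃ₗᵢ[ℝ] E) :
    MeasurePreserving L (sphereMeasure E) (sphereMeasure E) := by
  refine ⟨L.continuous.measurable, ?_⟩
  have h : MeasurePreserving L (volume.restrict (Metric.ball (0 : E) 1))
      (volume.restrict (Metric.ball (0 : E) 1)) := by
    have := L.measurePreserving.restrict_preimage (s := Metric.ball (0 : E) 1)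
      Metric.isOpen_ball.measurableSet
    simpa using this
  conv_rhs => rw [sphereMeasure, ← h.map_eq]
  rw [sphereMeasure, Measure.map_map L.continuous.measurable measurable_radialProjection,
    Measure.map_map measurable_radialProjection L.continuous.measurable]
  congr 1
  ext u
  simp

theorem sphereMeasure_singleton (hE : 2 ≤ Module.finrank ℝ E) (x : E) :
    sphereMeasure E {x} = 0 := by
  have : Nontrivial E := Module.nontrivial_of_finrank_pos (R := ℝ) (by omega)
  rw [sphereMeasure, Measure.map_apply measurable_radialProjection (measurableSet_singleton x)]
  refine measure_mono_null (t := (ℝ ∙ x : Submodule ℝ E)) (fun u hu => ?_)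
    (Measure.restrict_apply_eq_zero' Metric.isOpen_ball.measurableSet |>.2 <|
      measure_mono_null Set.inter_subset_left <| Measure.addHaar_submodule _ _ fun h => ?_)
  · rcases eq_or_ne u 0 with rfl | h0
    · exact Submodule.zero_mem _
    · rw [SetLike.mem_coe, Submodule.mem_span_singleton]
      refine ⟨‖u‖, ?_⟩
      rw [← Set.mem_singleton_iff.1 hu, smul_inv_smul₀ (norm_ne_zero_iff.2 h0)]
  · have := finrank_span_le_card (R := ℝ) ({x} : Set E)
    rw [h, finrank_top] at this
    simp at this
    omega

theorem eq_zero_of_ae_sphereMeasure {f : E → ℝ} (hf : Continuous f)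
    (h : f =ᵐ[sphereMeasure E] 0) {x : E} (hx : x ∈ Metric.sphere (0 : E) 1) : f x = 0 := by
  have hx1 : ‖x‖ = 1 := by simpa using hx
  have h1 : ∀ᵐ u ∂(volume.restrict (Metric.ball (0 : E) 1)), f (‖u‖⁻¹ • u) = 0 :=
    ae_of_ae_map measurable_radialProjection.aemeasurable h
  have hopen : IsOpen (Metric.ball (0 : E) 1 \ {0}) :=
    Metric.isOpen_ball.sdiff isClosed_singleton
  have h2 := Measure.eqOn_open_of_ae_eq (μ := (volume : Measure E)) (f := fun u => f (‖u‖⁻¹ • u))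
    (g := fun _ => (0 : ℝ))
    (ae_restrict_of_ae_restrict_of_subset Set.sdiff_subset h1) hopen
    (hf.comp_continuousOn ((continuousOn_id.norm.inv₀ fun u hu => norm_ne_zero_iff.2 hu.2).smul
      continuousOn_id)) continuousOn_const
  have h3 := h2 (x := (2⁻¹ : ℝ) • x) ⟨by simp [norm_smul, hx1]; norm_num, by
    simp [← norm_ne_zero_iff, hx1]⟩
  simpa [norm_smul, hx1, smul_smul] using h3

end sphereMeasure

theorem integrableOn_abs_rpow {e : ℝ} (he : -1 < e) :
    IntegrableOn (fun t : ℝ => |t| ^ e) (Set.Icc (-1) 1) := by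
  have h01 : IntervalIntegrable (fun t : ℝ => |t| ^ e) volume 0 1 := by
    refine (intervalIntegral.intervalIntegrable_rpow' (a := 0) (b := 1) he).congr fun t ht => ?_
    rw [Set.uIoc_of_le zero_le_one] at ht
    simp only [abs_of_pos ht.1]
  have h10 : IntervalIntegrable (fun t : ℝ => |t| ^ e) volume (-1) 0 := by
    rw [IntervalIntegrable.iff_comp_neg]
    simpa using h01.symm
  exact (intervalIntegrable_iff_integrableOn_Icc_of_le (by norm_num)).1 (h10.trans h01)

theorem integrable_riesz_sphereMeasure {d : ℕ} (hd : 1 ≤ d) {x : EuclideanSpace ℝ (Fin (d + 1))}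
    (hx : x ∈ Metric.sphere (0 : EuclideanSpace ℝ (Fin (d + 1))) 1) :
    Integrable (fun y => ‖x - y‖ ^ (-((d : ℝ) - 1)))
      (sphereMeasure (EuclideanSpace ℝ (Fin (d + 1)))) := by
  have hd1 : (1 : ℝ) ≤ d := by exact_mod_cast hd
  have hd0 : (0 : ℝ) < d := by positivity
  set e₀ : EuclideanSpace ℝ (Fin (d + 1)) := EuclideanSpace.single 0 1 with he₀
  obtain ⟨L, -, hL⟩ := exists_swap_isometry (y := x) (z := e₀)
    (by rw [mem_sphere_zero_iff_norm.1 hx, he₀]; simp)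
  rw [← (measurePreserving_sphereMeasure L).integrable_comp_emb L.toHomeomorph.measurableEmbedding]
  simp only [Function.comp_def, ← hL, ← map_sub, L.norm_map]
  rw [sphereMeasure, integrable_map_measure (by fun_prop : Measurable
    fun y => ‖e₀ - y‖ ^ (-((d : ℝ) - 1))).aestronglyMeasurable
    measurable_radialProjection.aemeasurable]
  -- The kernel is dominated by a product of integrable functions of the coordinates.
  set q : Fin (d + 1) → ℝ := fun i => if i = 0 then 0 else -(((d : ℝ) - 1) / d) with hq
  have hq0 : ∀ i, q i ≤ 0 := fun i => by
    simp only [hq]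
    split_ifs
    · exact le_rfl
    · exact neg_nonpos.2 (div_nonneg (by linarith) hd0.le)
  have hq1 : ∀ i, -1 < q i := fun i => by
    simp only [hq]
    split_ifs
    · norm_num
    · rw [neg_lt_neg_iff, div_lt_one hd0]
      linarith
  set h : Fin (d + 1) → ℝ → ℝ := fun i => (Set.Icc (-1) 1).indicator fun t => |t| ^ q i with hh
  have hprod : Integrable fun u : EuclideanSpace ℝ (Fin (d + 1)) => ∏ i, h i (u i) :=
    (PiLp.volume_preserving_ofLp (Fin (d + 1))).integrable_comp_of_integrable
      (Integrable.fintype_prod (f := h) fun i =>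
        (integrableOn_abs_rpow (hq1 i)).integrable_indicator measurableSet_Icc)
  have hne : ∀ᵐ u : EuclideanSpace ℝ (Fin (d + 1)), ∀ i, u i ≠ 0 := by
    refine (PiLp.volume_preserving_ofLp (Fin (d + 1))).quasiMeasurePreserving.ae
      (p := fun v => ∀ i, v i ≠ 0) (ae_all_iff.2 fun i => ?_)
    simpa [ae_iff, volume_pi] using
      Measure.pi_hyperplane (fun _ : Fin (d + 1) => (volume : Measure ℝ)) i 0
  refine hprod.restrict.mono' (by fun_prop : Measurable fun u =>
    ‖e₀ - ‖u‖⁻¹ • u‖ ^ (-((d : ℝ) - 1))).aestronglyMeasurable ?_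
  filter_upwards [ae_restrict_of_ae hne, ae_restrict_mem Metric.isOpen_ball.measurableSet]
    with u hu hball
  have hu1 : ‖u‖ < 1 := mem_ball_zero_iff.1 hball
  have hui : ∀ i, |u i| ≤ ‖u‖ := fun i => PiLp.norm_apply_le u i
  have hu0 : 0 < ‖u‖ := (abs_pos.2 (hu 0)).trans_le (hui 0)
  set r := ‖e₀ - ‖u‖⁻¹ • u‖
  have hri : ∀ i, i ≠ 0 → |u i| ≤ r := fun i hi => by
    have := PiLp.norm_apply_le (e₀ - ‖u‖⁻¹ • u) i
    simp only [PiLp.sub_apply, PiLp.smul_apply, he₀, PiLp.single_apply, hi, if_false, zero_sub,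
      norm_neg, smul_eq_mul, norm_mul, norm_inv, norm_norm] at this
    refine le_trans ?_ this
    exact le_mul_of_one_le_left (abs_nonneg _) ((one_le_inv₀ hu0).2 hu1.le)
  have hrprod : r ^ (-((d : ℝ) - 1)) = ∏ i, r ^ q i := by
    rw [Fin.prod_univ_succ]
    simp only [hq, if_true, Fin.succ_ne_zero, if_false, Real.rpow_zero, one_mul,
      Finset.prod_const, Finset.card_univ, Fintype.card_fin]
    rw [← Real.rpow_mul_natCast (norm_nonneg _)]
    congr 1
    field_simp
  rw [Function.comp_apply, Real.norm_of_nonneg (by positivity), hrprod]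
  refine Finset.prod_le_prod (fun i _ => by positivity) fun i _ => ?_
  simp only [hh]
  rw [Set.indicator_of_mem (Set.mem_Icc.2 (abs_le.1 ((hui i).trans hu1.le)))]
  rcases eq_or_ne i 0 with rfl | hi
  · simp [hq]
  · exact Real.rpow_le_rpow_of_nonpos (abs_pos.2 (hu i)) (hri i hi) (hq0 i)

theorem continuous_zonal_average {E : Type*} [NormedAddCommGroup E] [InnerProductSpace ℝ E]
    [MeasurableSpace E] [BorelSpace E] [SecondCountableTopology E] {g : ℝ → ℝ}
    (hg : Continuous g) {B : ℝ} (hB : ∀ r, |g r| ≤ B) (μ : Measure E) [IsFiniteMeasure μ] :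
    Continuous fun x : E => ∫ z, g (inner ℝ x z) ∂μ :=
  continuous_of_dominated (fun x => (by fun_prop : Continuous fun z : E =>
    g (inner ℝ x z)).aestronglyMeasurable) (fun x => ae_of_all _ fun z => hB _)
    (integrable_const B) (ae_of_all _ fun z => by fun_prop)

theorem norm_zonal_average_le {E : Type*} [NormedAddCommGroup E] [InnerProductSpace ℝ E]
    [MeasurableSpace E] {g : ℝ → ℝ} {B : ℝ} (hB : ∀ r, |g r| ≤ B)
    (μ : Measure E) [IsFiniteMeasure μ] (x : E) :
    ‖∫ z, g (inner ℝ x z) ∂μ‖ ≤ B * μ.real Set.univ :=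
  norm_integral_le_of_norm_le_const (ae_of_all _ fun _ => hB _)

section RieszPotential

variable {E : Type*} [NormedAddCommGroup E] [InnerProductSpace ℝ E]
    [FiniteDimensional ℝ E] [MeasurableSpace E] [BorelSpace E]

/-- Zonal kernels commute on the sphere. -/
theorem integral_zonal_swap (k g : ℝ → ℝ) {y z : E} (hy : y ∈ Metric.sphere (0 : E) 1)
    (hz : z ∈ Metric.sphere (0 : E) 1) :
    ∫ x, k ‖y - x‖ * g (inner ℝ x z) ∂sphereMeasure E =
      ∫ x, k ‖z - x‖ * g (inner ℝ x y) ∂sphereMeasure E := by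
  rw [mem_sphere_zero_iff_norm] at hy hz
  obtain ⟨L, hLy, hLz⟩ := exists_swap_isometry (hy.trans hz.symm)
  rw [← (measurePreserving_sphereMeasure L).integral_comp L.toHomeomorph.measurableEmbedding]
  refine integral_congr_ae (ae_of_all _ fun x => ?_)
  dsimp only
  conv_lhs => rw [← hLz, ← map_sub, L.norm_map]
  rw [← L.inner_map_map x y, hLy]

theorem integrable_prod_riesz {s : ℝ}
    (hk : ∀ x ∈ Metric.sphere (0 : E) 1,
      Integrable (fun y => ‖x - y‖ ^ (-s)) (sphereMeasure E))
    {μ : Measure E} [IsFiniteMeasure μ] (hμ : ∀ᵐ x ∂μ, x ∈ Metric.sphere (0 : E) 1) :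
    Integrable (fun p : E × E => ‖p.1 - p.2‖ ^ (-s)) (μ.prod (sphereMeasure E)) := by
  rw [integrable_prod_iff
    (by fun_prop : Measurable fun p : E × E => ‖p.1 - p.2‖ ^ (-s)).aestronglyMeasurable]
  refine ⟨hμ.mono fun x hx => hk x hx, ?_⟩
  rcases Set.eq_empty_or_nonempty (Metric.sphere (0 : E) 1) with hS | ⟨x₀, hx₀⟩
  · have : μ = 0 := by simpa [hS] using hμ
    simp [this]
  refine (integrable_const (∫ y, ‖x₀ - y‖ ^ (-s) ∂sphereMeasure E)).congr ?_
  filter_upwards [hμ] with x hx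
  have h := integral_zonal_swap (fun r => r ^ (-s)) (fun _ => 1) hx₀ hx
  simp only [mul_one] at h
  rw [h]
  refine integral_congr_ae (ae_of_all _ fun y => ?_)
  exact (Real.norm_of_nonneg (by positivity)).symm

/-- The potential of a zonal average of `μ` is the zonal average of the potential of `μ`. -/
theorem riesz_potential_zonal_average {s : ℝ}
    (hk : ∀ x ∈ Metric.sphere (0 : E) 1,
      Integrable (fun y => ‖x - y‖ ^ (-s)) (sphereMeasure E))
    {g : ℝ → ℝ} (hg : Continuous g) {B : ℝ} (hB : ∀ r, |g r| ≤ B)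
    {μ : Measure E} [IsFiniteMeasure μ] (hμ : ∀ᵐ x ∂μ, x ∈ Metric.sphere (0 : E) 1)
    {y : E} (hy : y ∈ Metric.sphere (0 : E) 1) :
    ∫ x, ‖y - x‖ ^ (-s) * ∫ z, g (inner ℝ x z) ∂μ ∂sphereMeasure E =
      ∫ x, g (inner ℝ x y) * ∫ z, ‖x - z‖ ^ (-s) ∂μ ∂sphereMeasure E := by
  have h1 : Integrable (Function.uncurry fun x z => ‖y - x‖ ^ (-s) * g (inner ℝ x z))
      ((sphereMeasure E).prod μ) :=
    ((hk y hy).comp_fst μ).mul_bdd (c := B)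
      (by fun_prop : Continuous fun p : E × E => g (inner ℝ p.1 p.2)).aestronglyMeasurable
      (ae_of_all _ fun p => hB _)
  have h2 : Integrable (Function.uncurry fun z x => ‖z - x‖ ^ (-s) * g (inner ℝ x y))
      (μ.prod (sphereMeasure E)) :=
    (integrable_prod_riesz hk hμ).mul_bdd (c := B)
      (by fun_prop : Continuous fun p : E × E => g (inner ℝ p.2 y)).aestronglyMeasurable
      (ae_of_all _ fun p => hB _)
  calc _ = ∫ x, ∫ z, ‖y - x‖ ^ (-s) * g (inner ℝ x z) ∂μ ∂sphereMeasure E := by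
        simp only [integral_const_mul]
    _ = ∫ z, ∫ x, ‖y - x‖ ^ (-s) * g (inner ℝ x z) ∂sphereMeasure E ∂μ :=
        integral_integral_swap h1
    _ = ∫ z, ∫ x, ‖z - x‖ ^ (-s) * g (inner ℝ x y) ∂sphereMeasure E ∂μ :=
        integral_congr_ae (hμ.mono fun z hz =>
          integral_zonal_swap (fun r => r ^ (-s)) g hy hz)
    _ = ∫ x, ∫ z, ‖z - x‖ ^ (-s) * g (inner ℝ x y) ∂μ ∂sphereMeasure E :=
        integral_integral_swap h2
    _ = _ := by simp only [integral_mul_const, mul_comm (g _), norm_sub_rev]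

theorem integrable_zonal_mul_riesz_potential {s : ℝ}
    (hk : ∀ x ∈ Metric.sphere (0 : E) 1,
      Integrable (fun y => ‖x - y‖ ^ (-s)) (sphereMeasure E))
    {g : ℝ → ℝ} (hg : Continuous g) {B : ℝ} (hB : ∀ r, |g r| ≤ B)
    {μ : Measure E} [IsFiniteMeasure μ] (hμ : ∀ᵐ x ∂μ, x ∈ Metric.sphere (0 : E) 1) (y : E) :
    Integrable (fun x => g (inner ℝ x y) * ∫ z, ‖x - z‖ ^ (-s) ∂μ) (sphereMeasure E) := by
  have h := (integrable_prod_riesz hk hμ).integral_prod_right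
  simp only [norm_sub_rev] at h
  exact h.bdd_mul (c := B) (by fun_prop : Continuous fun x : E =>
    g (inner ℝ x y)).aestronglyMeasurable (ae_of_all _ fun _ => hB _)

/-- Finite measures on the sphere of equal mass whose Riesz potentials differ by a constant
have the same zonal averages. -/
theorem zonal_average_eq_of_riesz_potential (hE : 2 ≤ Module.finrank ℝ E) {s : ℝ} (hs : 0 < s)
    (hk : ∀ x ∈ Metric.sphere (0 : E) 1,
      Integrable (fun y => ‖x - y‖ ^ (-s)) (sphereMeasure E))
    {g : ℝ → ℝ} (hg : Continuous g) {B : ℝ} (hB : ∀ r, |g r| ≤ B)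
    {μ ν : Measure E} [IsFiniteMeasure μ] [IsFiniteMeasure ν]
    (hμ : ∀ᵐ x ∂μ, x ∈ Metric.sphere (0 : E) 1) (hν : ∀ᵐ x ∂ν, x ∈ Metric.sphere (0 : E) 1)
    (hmass : μ.real Set.univ = ν.real Set.univ) {C : ℝ}
    (hC : ∀ x ∈ Metric.sphere (0 : E) 1,
      (∫ z, ‖x - z‖ ^ (-s) ∂μ) - ∫ z, ‖x - z‖ ^ (-s) ∂ν = C)
    {x : E} (hx : x ∈ Metric.sphere (0 : E) 1) :
    ∫ z, g (inner ℝ x z) ∂μ = ∫ z, g (inner ℝ x z) ∂ν := by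
  have : Nontrivial E := Module.nontrivial_of_finrank_pos (R := ℝ) (by omega)
  have hm := ae_sphereMeasure_mem_sphere (E := E)
  set m := sphereMeasure E with hmdef
  set f : E → ℝ := fun x => (∫ z, g (inner ℝ x z) ∂μ) - ∫ z, g (inner ℝ x z) ∂ν with hf
  have hfc : Continuous f :=
    (continuous_zonal_average hg hB μ).sub (continuous_zonal_average hg hB ν)
  have hfb : ∀ x, ‖f x‖ ≤ B * μ.real Set.univ + B * ν.real Set.univ := fun x =>
    (norm_sub_le _ _).trans <|
      add_le_add (norm_zonal_average_le hB μ x) (norm_zonal_average_le hB ν x)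
  have hfi : Integrable f m := Integrable.of_bound hfc.aestronglyMeasurable _ (ae_of_all _ hfb)
  have hmean : ∀ y ∈ Metric.sphere (0 : E) 1, ∫ x, g (inner ℝ x y) ∂m =
      ∫ w, g (inner ℝ w x) ∂m := fun y hy => by
    simpa using integral_zonal_swap (fun _ => 1) g hx hy
  have havg : ∀ (ρ : Measure E) [IsFiniteMeasure ρ], (∀ᵐ x ∂ρ, x ∈ Metric.sphere (0 : E) 1) →
      ∫ x, ∫ z, g (inner ℝ x z) ∂ρ ∂m = ρ.real Set.univ * ∫ w, g (inner ℝ w x) ∂m :=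
    fun ρ _ hρ => by
      have hint : Integrable (Function.uncurry fun x z : E => g (inner ℝ x z)) (m.prod ρ) :=
        Integrable.of_bound (by fun_prop : Continuous fun p : E × E =>
          g (inner ℝ p.1 p.2)).aestronglyMeasurable B (ae_of_all _ fun _ => hB _)
      rw [integral_integral_swap hint, integral_congr_ae (hρ.mono hmean), integral_const,
        smul_eq_mul]
  have hf0 : ∫ x, f x ∂m = 0 := by
    rw [integral_sub, havg μ hμ, havg ν hν, hmass, sub_self]
    · exact Integrable.of_bound (continuous_zonal_average hg hB μ).aestronglyMeasurable _
        (ae_of_all _ (norm_zonal_average_le hB μ))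
    · exact Integrable.of_bound (continuous_zonal_average hg hB ν).aestronglyMeasurable _
        (ae_of_all _ (norm_zonal_average_le hB ν))
  have hpot : ∀ y ∈ Metric.sphere (0 : E) 1,
      ∫ w, ‖y - w‖ ^ (-s) * f w ∂m = (∫ w, g (inner ℝ w x) ∂m) * C := fun y hy => by
    have hki : ∀ (ρ : Measure E) [IsFiniteMeasure ρ],
        Integrable (fun w => ‖y - w‖ ^ (-s) * ∫ z, g (inner ℝ w z) ∂ρ) m := fun ρ _ =>
      (hk y hy).mul_bdd (continuous_zonal_average hg hB ρ).aestronglyMeasurable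
        (ae_of_all _ (norm_zonal_average_le hB ρ))
    simp only [hf, mul_sub]
    rw [integral_sub (hki μ) (hki ν), riesz_potential_zonal_average hk hg hB hμ hy,
      riesz_potential_zonal_average hk hg hB hν hy,
      ← integral_sub (integrable_zonal_mul_riesz_potential hk hg hB hμ y)
        (integrable_zonal_mul_riesz_potential hk hg hB hν y), ← hmean y hy, ← integral_mul_const]
    refine integral_congr_ae (hm.mono fun w hw => ?_)
    dsimp only
    rw [← mul_sub, hC w hw]
  have hdiag : ∀ᵐ p ∂(m.prod m), p.1 ≠ p.2 := by
    have hset : MeasurableSet {p : E × E | p.1 = p.2} :=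
      measurableSet_eq_fun measurable_fst measurable_snd
    have : (m.prod m) {p : E × E | p.1 = p.2} = 0 := by
      rw [Measure.measure_prod_null hset]
      refine ae_of_all _ fun y => ?_
      refine Eq.trans (congrArg m ?_) (sphereMeasure_singleton hE y)
      ext w
      simp [eq_comm]
    simpa [ae_iff] using this
  have hint : Integrable (fun p : E × E => ‖p.1 - p.2‖ ^ (-s) * (f p.1 * f p.2)) (m.prod m) := by
    refine (integrable_prod_riesz hk hm).mul_bdd
      (c := (B * μ.real Set.univ + B * ν.real Set.univ) ^ 2)
      (by fun_prop : Continuous fun p : E × E => f p.1 * f p.2).aestronglyMeasurable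
      (ae_of_all _ fun p => ?_)
    rw [norm_mul, sq]
    exact mul_le_mul (hfb _) (hfb _) (norm_nonneg _) ((norm_nonneg _).trans (hfb p.1))
  have henergy : ∫ p : E × E, ‖p.1 - p.2‖ ^ (-s) * (f p.1 * f p.2) ∂(m.prod m) = 0 := by
    rw [integral_prod _ hint]
    have : ∀ᵐ y ∂m, ∫ w, ‖y - w‖ ^ (-s) * (f y * f w) ∂m =
        f y * ((∫ w, g (inner ℝ w x) ∂m) * C) := hm.mono fun y hy => by
      rw [← hpot y hy, ← integral_const_mul]
      exact integral_congr_ae (ae_of_all _ fun w => mul_left_comm _ _ _)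
    rw [integral_congr_ae this, integral_mul_const, hf0, zero_mul]
  exact sub_eq_zero.1 (eq_zero_of_ae_sphereMeasure hfc
    (ae_eq_zero_of_riesz_energy_eq_zero hfi hs hdiag hint henergy) hx)

theorem measure_eq_of_riesz_potential (hE : 2 ≤ Module.finrank ℝ E) {s : ℝ} (hs : 0 < s)
    (hk : ∀ x ∈ Metric.sphere (0 : E) 1,
      Integrable (fun y => ‖x - y‖ ^ (-s)) (sphereMeasure E))
    {μ ν : Measure E} [IsFiniteMeasure μ] [IsFiniteMeasure ν]
    (hμ : ∀ᵐ x ∂μ, x ∈ Metric.sphere (0 : E) 1) (hν : ∀ᵐ x ∂ν, x ∈ Metric.sphere (0 : E) 1)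
    (hmass : μ.real Set.univ = ν.real Set.univ) {C : ℝ}
    (hC : ∀ x ∈ Metric.sphere (0 : E) 1,
      (∫ z, ‖x - z‖ ^ (-s) ∂μ) - ∫ z, ‖x - z‖ ^ (-s) ∂ν = C) : μ = ν := by
  have : Nontrivial E := Module.nontrivial_of_finrank_pos (R := ℝ) (by omega)
  refine Measure.ext_of_charFun (funext fun t => ?_)
  obtain ⟨x, hx, r, rfl⟩ : ∃ x ∈ Metric.sphere (0 : E) 1, ∃ r : ℝ, t = r • x := by
    rcases eq_or_ne t 0 with rfl | ht
    · obtain ⟨x, hx⟩ := (NormedSpace.sphere_nonempty (x := (0 : E)) (r := 1)).2 zero_le_one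
      exact ⟨x, hx, 0, by simp⟩
    · have ht' := norm_ne_zero_iff.2 ht
      exact ⟨‖t‖⁻¹ • t, by simp [norm_smul, ht], ‖t‖, by simp [smul_smul, ht']⟩
  have hcos := zonal_average_eq_of_riesz_potential hE hs hk (g := fun u => Real.cos (r * u))
    (by fun_prop) (fun u => Real.abs_cos_le_one _) hμ hν hmass hC hx
  have hsin := zonal_average_eq_of_riesz_potential hE hs hk (g := fun u => Real.sin (r * u))
    (by fun_prop) (fun u => Real.abs_sin_le_one _) hμ hν hmass hC hx
  have hchar : ∀ (ρ : Measure E) [IsFiniteMeasure ρ], charFun ρ (r • x) =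
      ((∫ z, Real.cos (r * inner ℝ x z) ∂ρ : ℝ) : ℂ) +
        ((∫ z, Real.sin (r * inner ℝ x z) ∂ρ : ℝ) : ℂ) * Complex.I := fun ρ _ => by
    rw [charFun_apply, ← integral_complex_ofReal, ← integral_complex_ofReal,
      ← integral_mul_const, ← integral_add]
    · refine integral_congr_ae (ae_of_all _ fun z => ?_)
      dsimp only
      rw [Complex.exp_mul_I, inner_smul_right, real_inner_comm, Complex.ofReal_cos,
        Complex.ofReal_sin]
    · exact (Integrable.of_bound (by fun_prop : Continuous fun z : E =>
        Real.cos (r * inner ℝ x z)).aestronglyMeasurable 1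
        (ae_of_all _ fun z => Real.abs_cos_le_one _)).ofReal
    · exact ((Integrable.of_bound (by fun_prop : Continuous fun z : E =>
        Real.sin (r * inner ℝ x z)).aestronglyMeasurable 1
        (ae_of_all _ fun z => Real.abs_sin_le_one _)).ofReal).mul_const _
  rw [hchar μ, hchar ν, hcos, hsin]

end RieszPotential

theorem ae_add_mem_of_compl_null {α : Type*} [MeasurableSpace α] {μ ν : Measure α} {S : Set α}
    (hμ : μ Sᶜ = 0) (hν : ν Sᶜ = 0) : ∀ᵐ x ∂(μ + ν), x ∈ S := by
  rw [ae_iff]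
  change (μ + ν) Sᶜ = 0
  simp [hμ, hν]

theorem signedMeasure_apply_eq_of_compl_null {α : Type*} [MeasurableSpace α] (η : SignedMeasure α)
    {S : Set α} (hS : MeasurableSet S) (hp : η.toJordanDecomposition.posPart Sᶜ = 0)
    (hn : η.toJordanDecomposition.negPart Sᶜ = 0) :
    η S = η.toJordanDecomposition.posPart.real Set.univ -
      η.toJordanDecomposition.negPart.real Set.univ := by
  have h : ∀ μ : Measure α, μ Sᶜ = 0 → μ.real S = μ.real Set.univ := fun μ hμ => by
    rw [measureReal_def, measureReal_def]
    congr 1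
    exact measure_congr (Filter.eventuallyEq_univ.2 (mem_ae_iff.2 hμ))
  conv_lhs => rw [← η.toSignedMeasure_toJordanDecomposition]
  rw [JordanDecomposition.toSignedMeasure, Measure.toSignedMeasure_sub_apply hS, h _ hp, h _ hn]

theorem signedMeasure_eq_of_jordan_add_eq {α : Type*} [MeasurableSpace α] {η₁ η₂ : SignedMeasure α}
    (h : η₁.toJordanDecomposition.posPart + η₂.toJordanDecomposition.negPart =
      η₂.toJordanDecomposition.posPart + η₁.toJordanDecomposition.negPart) : η₁ = η₂ := by
  rw [← η₁.toSignedMeasure_toJordanDecomposition, ← η₂.toSignedMeasure_toJordanDecomposition,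
    JordanDecomposition.toSignedMeasure, JordanDecomposition.toSignedMeasure,
    sub_eq_sub_iff_add_eq_add, ← Measure.toSignedMeasure_add, ← Measure.toSignedMeasure_add]
  exact Measure.toSignedMeasure_congr h

/-- Uniqueness of the signed equilibrium: if `η₁`, `η₂` are finite signed
Borel measures supported on the unit sphere `S^d ⊂ ℝ^{d+1}` (`d ≥ 2`) with total mass `1`,
whose Newtonian potentials `V^{η_i}(x) = ∫ ‖x−y‖^{1−d} dη_i(y)` (computed via the Jordan
decomposition) are finite on `S^d` and satisfy `V^{η_i}(x) + Q(x) = F_i` on `S^d` for a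
continuous external field `Q`, then `η₁ = η₂` and `F₁ = F₂`. -/
theorem signed_equilibrium_unique (d : ℕ) (hd : 2 ≤ d)
    (Q : EuclideanSpace ℝ (Fin (d + 1)) → ℝ) (hQ : Continuous Q)
    (η₁ η₂ : SignedMeasure (EuclideanSpace ℝ (Fin (d + 1))))
    (hsupp₁p : η₁.toJordanDecomposition.posPart
      (Metric.sphere (0 : EuclideanSpace ℝ (Fin (d + 1))) 1)ᶜ = 0)
    (hsupp₁n : η₁.toJordanDecomposition.negPart
      (Metric.sphere (0 : EuclideanSpace ℝ (Fin (d + 1))) 1)ᶜ = 0)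
    (hsupp₂p : η₂.toJordanDecomposition.posPart
      (Metric.sphere (0 : EuclideanSpace ℝ (Fin (d + 1))) 1)ᶜ = 0)
    (hsupp₂n : η₂.toJordanDecomposition.negPart
      (Metric.sphere (0 : EuclideanSpace ℝ (Fin (d + 1))) 1)ᶜ = 0)
    (hmass₁ : η₁ (Metric.sphere (0 : EuclideanSpace ℝ (Fin (d + 1))) 1) = 1)
    (hmass₂ : η₂ (Metric.sphere (0 : EuclideanSpace ℝ (Fin (d + 1))) 1) = 1)
    (hint₁p : ∀ x ∈ Metric.sphere (0 : EuclideanSpace ℝ (Fin (d + 1))) 1,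
      Integrable (fun y => ‖x - y‖ ^ ((1 : ℝ) - d)) η₁.toJordanDecomposition.posPart)
    (hint₁n : ∀ x ∈ Metric.sphere (0 : EuclideanSpace ℝ (Fin (d + 1))) 1,
      Integrable (fun y => ‖x - y‖ ^ ((1 : ℝ) - d)) η₁.toJordanDecomposition.negPart)
    (hint₂p : ∀ x ∈ Metric.sphere (0 : EuclideanSpace ℝ (Fin (d + 1))) 1,
      Integrable (fun y => ‖x - y‖ ^ ((1 : ℝ) - d)) η₂.toJordanDecomposition.posPart)
    (hint₂n : ∀ x ∈ Metric.sphere (0 : EuclideanSpace ℝ (Fin (d + 1))) 1,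
      Integrable (fun y => ‖x - y‖ ^ ((1 : ℝ) - d)) η₂.toJordanDecomposition.negPart)
    (F₁ F₂ : ℝ)
    (heq₁ : ∀ x ∈ Metric.sphere (0 : EuclideanSpace ℝ (Fin (d + 1))) 1,
      ((∫ y, ‖x - y‖ ^ ((1 : ℝ) - d) ∂η₁.toJordanDecomposition.posPart) -
        (∫ y, ‖x - y‖ ^ ((1 : ℝ) - d) ∂η₁.toJordanDecomposition.negPart)) + Q x = F₁)
    (heq₂ : ∀ x ∈ Metric.sphere (0 : EuclideanSpace ℝ (Fin (d + 1))) 1,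
      ((∫ y, ‖x - y‖ ^ ((1 : ℝ) - d) ∂η₂.toJordanDecomposition.posPart) -
        (∫ y, ‖x - y‖ ^ ((1 : ℝ) - d) ∂η₂.toJordanDecomposition.negPart)) + Q x = F₂) :
    η₁ = η₂ ∧ F₁ = F₂ := by
  have hs : (0 : ℝ) < (d : ℝ) - 1 := by
    have : (2 : ℝ) ≤ d := by exact_mod_cast hd
    linarith
  simp only [← neg_sub (d : ℝ) 1] at *
  have hS : MeasurableSet (Metric.sphere (0 : EuclideanSpace ℝ (Fin (d + 1))) 1) :=
    Metric.isClosed_sphere.measurableSet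
  rw [signedMeasure_apply_eq_of_compl_null η₁ hS hsupp₁p hsupp₁n] at hmass₁
  rw [signedMeasure_apply_eq_of_compl_null η₂ hS hsupp₂p hsupp₂n] at hmass₂
  have hη : η₁ = η₂ := by
    refine signedMeasure_eq_of_jordan_add_eq (measure_eq_of_riesz_potential (by simp; omega) hs
      (fun x hx => integrable_riesz_sphereMeasure (by omega) hx)
      (ae_add_mem_of_compl_null hsupp₁p hsupp₂n) (ae_add_mem_of_compl_null hsupp₂p hsupp₁n)
      ?_ (C := F₁ - F₂) fun x hx => ?_)
    · rw [measureReal_add_apply, measureReal_add_apply]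
      linarith
    · rw [integral_add_measure (hint₁p x hx) (hint₂n x hx),
        integral_add_measure (hint₂p x hx) (hint₁n x hx)]
      linarith [heq₁ x hx, heq₂ x hx]
  subst hη
  obtain ⟨x, hx⟩ := (NormedSpace.sphere_nonempty
    (x := (0 : EuclideanSpace ℝ (Fin (d + 1)))) (r := 1)).2 zero_le_one
  exact ⟨rfl, (heq₁ x hx).symm.trans (heq₂ x hx)⟩
end

section
/- Let d ≥ 1 be an integer and q > 0 a real number. Then the polynomial G(d,q;z) = [(z−1)^d/q − z − 1]·z^{d−1} + (z−1)^d has exactly one real zero in the open interval (1, ∞). -/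
open Filter Topology

lemma inv_pow_sub_inv_add_one_pow_succ {x : ℝ} (hx : 0 < x) (n : ℕ) :
    x⁻¹ ^ (n + 1) - (x + 1)⁻¹ ^ (n + 1) =
      x⁻¹ * (x⁻¹ ^ n - (x + 1)⁻¹ ^ n) + (x + 1)⁻¹ ^ n * (x⁻¹ * (x + 1)⁻¹) := by
  have h : x⁻¹ * (x + 1)⁻¹ = x⁻¹ - (x + 1)⁻¹ := by
    field_simp
    ring
  rw [h]
  ring

lemma inv_add_one_pow_le_inv_pow {x : ℝ} (hx : 0 < x) (n : ℕ) :
    (x + 1)⁻¹ ^ n ≤ x⁻¹ ^ n := by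
  gcongr
  linarith

lemma inv_pow_sub_inv_add_one_pow_antitone {x y : ℝ} (hx : 0 < x) (hxy : x ≤ y) (n : ℕ) :
    y⁻¹ ^ n - (y + 1)⁻¹ ^ n ≤ x⁻¹ ^ n - (x + 1)⁻¹ ^ n := by
  have hy : 0 < y := hx.trans_le hxy
  induction n with
  | zero => simp
  | succ n ih =>
    rw [inv_pow_sub_inv_add_one_pow_succ hx, inv_pow_sub_inv_add_one_pow_succ hy]
    have h := sub_nonneg.2 (inv_add_one_pow_le_inv_pow hy n)
    gcongr

lemma inv_pow_sub_inv_add_one_pow_tendsto (n : ℕ) :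
    Tendsto (fun x : ℝ => x⁻¹ ^ n - (x + 1)⁻¹ ^ n) atTop (𝓝 0) := by
  have h₀ : Tendsto (fun x : ℝ => x⁻¹) atTop (𝓝 0) := tendsto_inv_atTop_zero
  have h₁ : Tendsto (fun x : ℝ => (x + 1)⁻¹) atTop (𝓝 0) :=
    h₀.comp (tendsto_atTop_add_const_right _ 1 tendsto_id)
  simpa using (h₀.pow n).sub (h₁.pow n)

/-- The function of `x = z - 1` whose value is `1 / q` exactly at the zeros `z > 1` of the
generalized Gonchar polynomial of parameters `n + 1` and `q`. -/
noncomputable def goncharRatio (n : ℕ) (x : ℝ) : ℝ :=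
  x⁻¹ ^ n - (x + 1)⁻¹ ^ n + 2 * x⁻¹ ^ (n + 1)

lemma goncharRatio_strictAnti {x y : ℝ} (hx : 0 < x) (hxy : x < y) (n : ℕ) :
    goncharRatio n y < goncharRatio n x := by
  have h₁ := inv_pow_sub_inv_add_one_pow_antitone hx hxy.le n
  have h₂ : y⁻¹ ^ (n + 1) < x⁻¹ ^ (n + 1) :=
    pow_lt_pow_left₀ (inv_strictAnti₀ hx hxy) (inv_nonneg.2 (hx.trans hxy).le) n.succ_ne_zero
  unfold goncharRatio
  linarith

lemma goncharRatio_tendsto (n : ℕ) : Tendsto (goncharRatio n) atTop (𝓝 0) := by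
  have h₀ : Tendsto (fun x : ℝ => x⁻¹) atTop (𝓝 0) := tendsto_inv_atTop_zero
  have h := (inv_pow_sub_inv_add_one_pow_tendsto n).add ((h₀.pow (n + 1)).const_mul 2)
  rwa [zero_pow n.succ_ne_zero, mul_zero, add_zero] at h

lemma gonchar_eq_mul_sub_goncharRatio {z : ℝ} (hz : 1 < z) (n : ℕ) (q : ℝ) :
    ((z - 1) ^ (n + 1) / q - z - 1) * z ^ n + (z - 1) ^ (n + 1) =
      (z - 1) ^ (n + 1) * z ^ n * (1 / q - goncharRatio n (z - 1)) := by
  obtain ⟨x, rfl⟩ : ∃ x, z = x + 1 := ⟨z - 1, by ring⟩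
  have hx : x ≠ 0 := by linarith
  have hx' : x + 1 ≠ 0 := by linarith
  have h₁ : x ^ n * x⁻¹ ^ n = 1 := by rw [← mul_pow, mul_inv_cancel₀ hx, one_pow]
  have h₂ : (x + 1) ^ n * (x + 1)⁻¹ ^ n = 1 := by rw [← mul_pow, mul_inv_cancel₀ hx', one_pow]
  have h₃ : x * x⁻¹ = 1 := mul_inv_cancel₀ hx
  rw [goncharRatio, add_sub_cancel_right, pow_succ x, pow_succ x⁻¹]
  generalize x⁻¹ ^ n = a at *
  generalize (x + 1)⁻¹ ^ n = b at *
  generalize x ^ n = c at *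
  generalize (x + 1) ^ n = e at *
  linear_combination (x * e + 2 * e * x * x⁻¹) * h₁ + 2 * e * h₃ - c * x * h₂


/-- For every integer `d ≥ 1` and real `q > 0`, the generalized Gonchar
polynomial `G(d,q;z) = [(z−1)^d/q − z − 1]·z^{d−1} + (z−1)^d` has exactly one real zero
in the open interval `(1, ∞)`. -/
theorem gonchar_unique_zero (d : ℕ) (hd : 1 ≤ d) (q : ℝ) (hq : 0 < q) :
    ∃! z : ℝ, 1 < z ∧
      ((z - 1) ^ d / q - z - 1) * z ^ (d - 1) + (z - 1) ^ d = 0 := by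
  obtain ⟨n, rfl⟩ : ∃ n, d = n + 1 := ⟨d - 1, by omega⟩
  simp only [Nat.add_sub_cancel]
  have key {z : ℝ} (hz : 1 < z) :
      ((z - 1) ^ (n + 1) / q - z - 1) * z ^ n + (z - 1) ^ (n + 1) = 0 ↔
        goncharRatio n (z - 1) = 1 / q := by
    have h₁ : (z - 1) ^ (n + 1) ≠ 0 := pow_ne_zero _ (by linarith)
    have h₂ : z ^ n ≠ 0 := pow_ne_zero _ (by linarith)
    rw [gonchar_eq_mul_sub_goncharRatio hz, mul_eq_zero_iff_left (mul_ne_zero h₁ h₂),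
      sub_eq_zero, eq_comm]
  refine existsUnique_of_exists_of_unique ?_ ?_
  · obtain ⟨x, hxq, hx⟩ := (((goncharRatio_tendsto n).eventually_lt_const
      (one_div_pos.2 hq)).and (eventually_gt_atTop 0)).exists
    have hpos : 0 < ((x + 1 - 1) ^ (n + 1) / q - (x + 1) - 1) * (x + 1) ^ n
        + (x + 1 - 1) ^ (n + 1) := by
      rw [gonchar_eq_mul_sub_goncharRatio (by linarith), add_sub_cancel_right]
      have := sub_pos.2 hxq
      positivity
    have hcont : ContinuousOn (fun z : ℝ =>
        ((z - 1) ^ (n + 1) / q - z - 1) * z ^ n + (z - 1) ^ (n + 1)) (Set.Icc 1 (x + 1)) := by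
      fun_prop
    obtain ⟨z, hz, hz₀⟩ := intermediate_value_Ioo (by linarith) hcont
      (show (0 : ℝ) ∈ Set.Ioo _ _ from ⟨by norm_num, hpos⟩)
    exact ⟨z, hz.1, hz₀⟩
  · rintro y z ⟨hy, hy₀⟩ ⟨hz, hz₀⟩
    rw [key hy] at hy₀
    rw [key hz] at hz₀
    rcases lt_trichotomy y z with h | h | h
    · have := goncharRatio_strictAnti (sub_pos.2 hy) (sub_lt_sub_right h 1) n
      linarith
    · exact h
    · have := goncharRatio_strictAnti (sub_pos.2 hz) (sub_lt_sub_right h 1) n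
      linarith
end

section
/- Let d ≥ 1, q > 0, R > 1, let p ∈ S^d be a fixed unit vector and set a = R·p. Let R_q be the unique real zero in (1,∞) of G(d,q;z) = [(z−1)^d/q − z − 1]·z^{d−1} + (z−1)^d. Then the density η'_{R,q}(x) = 1 + q/R^{d−1} − q(R²−1)/‖x−a‖^{d+1} is nonnegative for every x ∈ S^d if and only if R ≥ R_q. -/
/-- The density of the signed equilibrium at the north pole `p`, multiplied by `z ^ k`, where
`d = k + 1` and `z` is the distance of the charge from the centre. -/
noncomputable def scaledPoleDensity (k : ℕ) (q z : ℝ) : ℝ :=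
  z ^ k + q - q * ((z + 1) / (z - 1) * (z / (z - 1)) ^ k)

theorem scaledPoleDensity_strictMonoOn (k : ℕ) {q : ℝ} (hq : 0 < q) :
    StrictMonoOn (scaledPoleDensity k q) (Set.Ioi 1) := by
  intro a (ha : 1 < a) b (hb : 1 < b) hab
  have ha' : 0 < a - 1 := by linarith
  have hb' : 0 < b - 1 := by linarith
  have h_pow : a ^ k ≤ b ^ k := pow_le_pow_left₀ (by linarith) hab.le k
  have h_quot : (b + 1) / (b - 1) < (a + 1) / (a - 1) := by
    rw [div_lt_div_iff₀ hb' ha']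
    nlinarith
  have h_base : b / (b - 1) ≤ a / (a - 1) := by
    rw [div_le_div_iff₀ hb' ha']
    nlinarith
  have h_quot_pow : (b / (b - 1)) ^ k ≤ (a / (a - 1)) ^ k :=
    pow_le_pow_left₀ (by positivity) h_base k
  have h_pos : 0 < (b / (b - 1)) ^ k := by positivity
  have h_mul : (b + 1) / (b - 1) * (b / (b - 1)) ^ k < (a + 1) / (a - 1) * (a / (a - 1)) ^ k :=
    mul_lt_mul h_quot h_quot_pow h_pos (by positivity)
  have := mul_lt_mul_of_pos_left h_mul hq
  simp only [scaledPoleDensity]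
  linarith

theorem scaledPoleDensity_eq_pow_mul (k : ℕ) (q : ℝ) {z : ℝ} (hz : 1 < z) :
    scaledPoleDensity k q z =
      z ^ k * (1 + q / z ^ k - q * (z ^ 2 - 1) / (z - 1) ^ (k + 2)) := by
  have h_ne : z - 1 ≠ 0 := by linarith
  have h_ne_zero : z ≠ 0 := by linarith
  rw [scaledPoleDensity, div_pow]
  field_simp
  ring

/-- A zero of the generalized Gonchar polynomial is a zero of the scaled density at the pole. -/
theorem scaledPoleDensity_eq_zero (k : ℕ) {q z : ℝ} (hq : 0 < q) (hz : 1 < z)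
    (h : ((z - 1) ^ (k + 1) / q - z - 1) * z ^ k + (z - 1) ^ (k + 1) = 0) :
    scaledPoleDensity k q z = 0 := by
  have h_ne : z - 1 ≠ 0 := by linarith
  have h_eq : scaledPoleDensity k q z =
      q / (z - 1) ^ (k + 1) *
        (((z - 1) ^ (k + 1) / q - z - 1) * z ^ k + (z - 1) ^ (k + 1)) := by
    rw [scaledPoleDensity, div_pow]
    field_simp
    ring
  rw [h_eq, h, mul_zero]

/-- On the unit sphere the density is smallest at the point closest to the charge. -/
theorem forall_sphere_density_nonneg_iff {E : Type*} [NormedAddCommGroup E] [NormedSpace ℝ E]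
    {p : E} (hp : ‖p‖ = 1) {q R : ℝ} (c : ℝ) (n : ℕ) (hq : 0 < q) (hR : 1 < R) :
    (∀ x ∈ Metric.sphere (0 : E) 1, 0 ≤ c - q * (R ^ 2 - 1) / ‖x - R • p‖ ^ n) ↔
      0 ≤ c - q * (R ^ 2 - 1) / (R - 1) ^ n := by
  have hR' : 0 < R - 1 := by linarith
  constructor
  · intro h
    have h_norm : ‖p - R • p‖ = R - 1 := by
      rw [show p - R • p = (1 - R) • p by rw [sub_smul, one_smul], norm_smul, hp, mul_one,
        Real.norm_eq_abs, abs_sub_comm, abs_of_pos hR']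
    simpa only [h_norm] using h p (by simpa using hp)
  · intro h x hx
    have hx' : ‖x‖ = 1 := by simpa using hx
    have h_le : R - 1 ≤ ‖x - R • p‖ := by
      have := norm_sub_norm_le (R • p) x
      rwa [norm_smul, hp, hx', mul_one, Real.norm_of_nonneg (by linarith), norm_sub_rev] at this
    have h_num : 0 ≤ q * (R ^ 2 - 1) := mul_nonneg hq.le (by nlinarith)
    have : q * (R ^ 2 - 1) / ‖x - R • p‖ ^ n ≤ q * (R ^ 2 - 1) / (R - 1) ^ n := by gcongr
    linarith

/-- The signed equilibrium density
`η'_{R,q}(x) = 1 + q/R^{d−1} − q(R²−1)/‖x−a‖^{d+1}`, `a = R·p`, is nonnegative everywhere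
on the unit sphere `S^d` if and only if `R ≥ R_q`, where `R_q` is the unique zero in
`(1,∞)` of the generalized Gonchar polynomial `G(d,q;z)`. -/
theorem gonchar_critical_distance (d : ℕ) (hd : 1 ≤ d) (q R Rq : ℝ) (hq : 0 < q)
    (hR : 1 < R)
    (p : EuclideanSpace ℝ (Fin (d + 1))) (hp : ‖p‖ = 1)
    (hRq : 1 < Rq ∧
      ((Rq - 1) ^ d / q - Rq - 1) * Rq ^ (d - 1) + (Rq - 1) ^ d = 0) :
    (∀ x ∈ Metric.sphere (0 : EuclideanSpace ℝ (Fin (d + 1))) 1,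
        0 ≤ 1 + q / R ^ (d - 1) - q * (R ^ 2 - 1) / ‖x - R • p‖ ^ (d + 1)) ↔ Rq ≤ R := by
  obtain ⟨k, rfl⟩ := Nat.exists_eq_add_of_le' hd
  obtain ⟨hRq_one, hG⟩ := hRq
  simp only [Nat.add_sub_cancel] at hG ⊢
  rw [forall_sphere_density_nonneg_iff hp _ _ hq hR,
    ← (scaledPoleDensity_strictMonoOn k hq).le_iff_le hRq_one hR,
    scaledPoleDensity_eq_zero k hq hRq_one hG, scaledPoleDensity_eq_pow_mul k q hR]
  exact (mul_nonneg_iff_of_pos_left (by positivity)).symm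
end

section
/- The unique real zero in (1,∞) of the Gonchar polynomial G(4;z) = [(z−1)⁴ − z − 1]·z³ + (z−1)⁴ equals 1 + ρ, where ρ is the unique real number satisfying ρ³ = ρ + 1 (the Plastic number). -/
theorem one_lt_of_cube_eq_add_one {x : ℝ} (hx : x ^ 3 = x + 1) : 1 < x := by
  have hpos : 0 < x := by
    by_contra! h
    nlinarith [mul_nonneg (neg_nonneg.mpr h) (sq_nonneg (x + 1)), sq_nonneg (2 * x + 1)]
  by_contra! h
  nlinarith [mul_nonneg (mul_nonneg hpos.le (sub_nonneg.mpr h)) (add_nonneg zero_le_one hpos.le)]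

theorem eq_of_cube_eq_add_one {x y : ℝ} (hx : x ^ 3 = x + 1) (hy : y ^ 3 = y + 1) : x = y := by
  have hx1 := one_lt_of_cube_eq_add_one hx
  have hy1 := one_lt_of_cube_eq_add_one hy
  have h : (x - y) * (x ^ 2 + x * y + y ^ 2 - 1) = 0 := by linear_combination hx - hy
  have hne : x ^ 2 + x * y + y ^ 2 - 1 ≠ 0 := by nlinarith
  exact sub_eq_zero.mp ((mul_eq_zero.mp h).resolve_right hne)

theorem gonchar_four_factorization (w : ℝ) :
    (((1 + w) - 1) ^ 4 - (1 + w) - 1) * (1 + w) ^ 3 + ((1 + w) - 1) ^ 4 =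
      (w ^ 3 - w - 1) * (w ^ 4 + 3 * w ^ 3 + 4 * w ^ 2 + 5 * w + 2) := by
  ring

/-- The unique real zero in `(1,∞)` of the Gonchar polynomial
`G(4;z) = [(z−1)⁴ − z − 1]·z³ + (z−1)⁴` equals `1 + ρ`, where `ρ` is the (unique) real
number satisfying `ρ³ = ρ + 1`, i.e. the Plastic number. -/
theorem gonchar_four_plastic_number (ρ : ℝ) (hρ : ρ ^ 3 = ρ + 1) :
    (1 : ℝ) < 1 + ρ ∧
    (((1 + ρ) - 1) ^ 4 - (1 + ρ) - 1) * (1 + ρ) ^ 3 + ((1 + ρ) - 1) ^ 4 = 0 ∧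
    ∀ z : ℝ, 1 < z → ((z - 1) ^ 4 - z - 1) * z ^ 3 + (z - 1) ^ 4 = 0 → z = 1 + ρ := by
  refine ⟨by linarith [one_lt_of_cube_eq_add_one hρ], ?_, fun z hz h => ?_⟩
  · rw [gonchar_four_factorization, hρ]
    ring
  · obtain ⟨w, rfl⟩ : ∃ w, z = 1 + w := ⟨z - 1, by ring⟩
    have hw : 0 < w := by linarith
    rw [gonchar_four_factorization] at h
    have hne : w ^ 4 + 3 * w ^ 3 + 4 * w ^ 2 + 5 * w + 2 ≠ 0 := by positivity
    have hw3 := (mul_eq_zero.mp h).resolve_right hne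
    rw [eq_of_cube_eq_add_one (x := w) (by linarith) hρ]
end

section
/- Fix q > 0 and for each integer d ≥ 1 let R_q(d) denote the unique real zero in (1,∞) of G(d,q;z) = [(z−1)^d/q − z − 1]·z^{d−1} + (z−1)^d. Then R_q(d) = 2 + (log(3q))/d + O(1/d²) as d → ∞; that is, there exist constants C > 0 and d₀ such that |R_q(d) − 2 − (log(3q))/d| ≤ C/d² for all d ≥ d₀. -/
/-- The equation `G(d,q;1+x) = 0`, with `d = n + 1`, in logarithmic form. -/
theorem gonchar_zero_log_eq {q x : ℝ} (hq : 0 < q) (hx : 0 < x) (n : ℕ)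
    (h : (x ^ (n + 1) / q - (x + 1) - 1) * (x + 1) ^ n + x ^ (n + 1) = 0) :
    (n + 1 : ℝ) * Real.log x =
      Real.log q + Real.log (x + 2) - Real.log (1 + q * ((x + 1) ^ n)⁻¹) := by
  have hp : 0 < (x + 1) ^ n := by positivity
  have hpow : x ^ (n + 1) = q * (x + 2) / (1 + q * ((x + 1) ^ n)⁻¹) := by
    field_simp at h ⊢
    linear_combination h
  have hlog := congrArg Real.log hpow
  rw [Real.log_pow, Real.log_div (by positivity) (by positivity),
    Real.log_mul (by positivity) (by positivity)] at hlog
  exact_mod_cast hlog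

theorem abs_log_add_two_sub_log_three_le {x : ℝ} (hx : 0 < x) :
    |Real.log (x + 2) - Real.log 3| ≤ |x - 1| := by
  have hup := Real.log_le_sub_one_of_pos (show 0 < (x + 2) / 3 by positivity)
  have hlo := Real.log_le_sub_one_of_pos (show 0 < 3 / (x + 2) by positivity)
  rw [Real.log_div (by positivity) (by positivity)] at hup hlo
  have hfrac : 3 / (x + 2) - 1 ≤ |x - 1| := by
    rw [sub_le_iff_le_add, div_le_iff₀ (by positivity)]
    rcases abs_cases (x - 1) with ⟨h, _⟩ | ⟨h, _⟩ <;> rw [h] <;> nlinarith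
  rw [abs_le]
  constructor
  · linarith
  · linarith [le_abs_self (x - 1), abs_nonneg (x - 1)]

/-- A bound `log x = O(1/n)` for zeros `1 + x` of the generalized Gonchar polynomial. -/
theorem gonchar_zero_abs_log_le {q x : ℝ} (hq : 0 < q) (hx : 0 < x) (n : ℕ) (hn : 1 ≤ n)
    (h : (n + 1 : ℝ) * Real.log x =
      Real.log q + Real.log (x + 2) - Real.log (1 + q * ((x + 1) ^ n)⁻¹)) :
    |Real.log x| ≤
      (2 * |Real.log (3 * q)| + |Real.log (2 * q / (1 + q))|) / (n + 1) := by
  have hn' : (1 : ℝ) ≤ n := by exact_mod_cast hn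
  have ht : ((x + 1) ^ n)⁻¹ ≤ 1 := inv_le_one_of_one_le₀ (one_le_pow₀ (by linarith))
  have ht0 : 0 < ((x + 1) ^ n)⁻¹ := by positivity
  rw [le_div_iff₀ (by positivity)]
  rcases le_total 1 x with h1 | h1
  · have hlog := Real.log_nonneg h1
    have hx2 : Real.log (x + 2) ≤ Real.log 3 + Real.log x := by
      rw [← Real.log_mul (by norm_num) hx.ne']
      exact Real.log_le_log (by positivity) (by linarith)
    have hpos : 0 ≤ Real.log (1 + q * ((x + 1) ^ n)⁻¹) :=
      Real.log_nonneg (by nlinarith)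
    have h3q : Real.log (3 * q) = Real.log 3 + Real.log q :=
      Real.log_mul (by norm_num) hq.ne'
    rw [abs_of_nonneg hlog]
    nlinarith [le_abs_self (Real.log (3 * q)), abs_nonneg (Real.log (2 * q / (1 + q)))]
  · have hlog := Real.log_nonpos hx.le h1
    have hx2 : Real.log 2 ≤ Real.log (x + 2) := Real.log_le_log (by norm_num) (by linarith)
    have hle : Real.log (1 + q * ((x + 1) ^ n)⁻¹) ≤ Real.log (1 + q) :=
      Real.log_le_log (by positivity) (by nlinarith)
    have h2q : Real.log (2 * q / (1 + q)) = Real.log 2 + Real.log q - Real.log (1 + q) := by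
      rw [Real.log_div (by positivity) (by positivity), Real.log_mul (by norm_num) hq.ne']
    rw [abs_of_nonpos hlog]
    nlinarith [neg_abs_le (Real.log (2 * q / (1 + q))), abs_nonneg (Real.log (3 * q))]

/-- Given a bound `|log x| ≤ A / (n + 1)`, the logarithmic equation determines `x`
up to `O(1/n²)`. -/
theorem gonchar_zero_abs_sub_le {q x A : ℝ} (hq : 0 < q) (hx : 0 < x) (n : ℕ)
    (hA : |Real.log x| ≤ A / (n + 1)) (hAn : 2 * A ≤ n + 1)
    (h : (n + 1 : ℝ) * Real.log x =
      Real.log q + Real.log (x + 2) - Real.log (1 + q * ((x + 1) ^ n)⁻¹)) :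
    |x - 1 - Real.log (3 * q) / (n + 1)| ≤ (A ^ 2 + 2 * A + 2 * q) / (n + 1) ^ 2 := by
  have hd : (0 : ℝ) < n + 1 := by positivity
  have hhalf : |Real.log x| ≤ 1 / 2 :=
    hA.trans (by rw [div_le_iff₀ hd]; linarith)
  have hx1 : 1 / 2 ≤ x := by
    have := Real.add_one_le_exp (Real.log x)
    rw [Real.exp_log hx] at this
    linarith [(abs_le.mp hhalf).1]
  have hquad : |x - 1 - Real.log x| ≤ Real.log x ^ 2 := by
    have := Real.abs_exp_sub_one_sub_id_le (x := Real.log x) (by linarith)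
    rwa [Real.exp_log hx] at this
  have hlin : |x - 1| ≤ 2 * (A / (n + 1)) := by
    have := Real.abs_exp_sub_one_le (x := Real.log x) (by linarith)
    rw [Real.exp_log hx] at this
    linarith
  have hsq : Real.log x ^ 2 ≤ (A / (n + 1)) ^ 2 := by
    rw [← sq_abs]
    gcongr
  have ht : ((x + 1) ^ n)⁻¹ ≤ 2 / (n + 1) := by
    have hb := one_add_mul_le_pow (a := x) (by linarith) n
    rw [add_comm 1 x] at hb
    have hn0 : (0 : ℝ) ≤ n := n.cast_nonneg
    rw [inv_le_comm₀ (by positivity) (by positivity), inv_div]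
    nlinarith
  have ht0 : 0 < ((x + 1) ^ n)⁻¹ := by positivity
  have hlog0 : 0 ≤ Real.log (1 + q * ((x + 1) ^ n)⁻¹) := Real.log_nonneg (by nlinarith)
  have hlog1 : Real.log (1 + q * ((x + 1) ^ n)⁻¹) ≤ q * (2 / (n + 1)) := by
    have := Real.log_le_sub_one_of_pos (show 0 < 1 + q * ((x + 1) ^ n)⁻¹ by positivity)
    nlinarith
  have h3q : Real.log (3 * q) = Real.log 3 + Real.log q :=
    Real.log_mul (by norm_num) hq.ne'
  have hmain : |(n + 1) * Real.log x - Real.log (3 * q)| ≤ (2 * A + 2 * q) / (n + 1) := by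
    have h3 := abs_le.mp ((abs_log_add_two_sub_log_three_le hx).trans hlin)
    have hsum : (2 * A + 2 * q) / (n + 1) = 2 * (A / (n + 1)) + q * (2 / (n + 1)) := by ring
    have hq2 : 0 ≤ q * (2 / ((n : ℝ) + 1)) := by positivity
    rw [h, h3q, hsum, abs_le]
    constructor <;> linarith [h3.1, h3.2]
  have hdiv : |Real.log x - Real.log (3 * q) / (n + 1)| ≤ (2 * A + 2 * q) / (n + 1) ^ 2 := by
    have : Real.log x - Real.log (3 * q) / (n + 1) =
        ((n + 1) * Real.log x - Real.log (3 * q)) / (n + 1) := by field_simp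
    rw [this, abs_div, abs_of_pos hd, div_le_iff₀ hd]
    refine hmain.trans (le_of_eq ?_)
    field_simp
  calc |x - 1 - Real.log (3 * q) / (n + 1)|
      = |(x - 1 - Real.log x) + (Real.log x - Real.log (3 * q) / (n + 1))| := by ring_nf
    _ ≤ |x - 1 - Real.log x| + |Real.log x - Real.log (3 * q) / (n + 1)| := abs_add_le _ _
    _ ≤ (A / (n + 1)) ^ 2 + (2 * A + 2 * q) / (n + 1) ^ 2 := by linarith
    _ = (A ^ 2 + 2 * A + 2 * q) / (n + 1) ^ 2 := by field_simp; ring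

/-- Fix `q > 0` and for each `d ≥ 1` let `R_q(d)` be the unique zero in
`(1,∞)` of `G(d,q;z) = [(z−1)^d/q − z − 1]·z^{d−1} + (z−1)^d`. Then
`R_q(d) = 2 + log(3q)/d + O(1/d²)` as `d → ∞`. -/
theorem gonchar_zero_asymptotics (q : ℝ) (hq : 0 < q) (Rq : ℕ → ℝ)
    (hRq : ∀ d : ℕ, 1 ≤ d → 1 < Rq d ∧
      ((Rq d - 1) ^ d / q - Rq d - 1) * (Rq d) ^ (d - 1) + (Rq d - 1) ^ d = 0) :
    ∃ C > (0 : ℝ), ∃ d₀ : ℕ, ∀ d : ℕ, d₀ ≤ d →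
      |Rq d - 2 - Real.log (3 * q) / d| ≤ C / d ^ 2 := by
  set A : ℝ := 2 * |Real.log (3 * q)| + |Real.log (2 * q / (1 + q))|
  have hA0 : 0 ≤ A := by positivity
  obtain ⟨N, hN⟩ := exists_nat_ge (2 * A)
  refine ⟨A ^ 2 + 2 * A + 2 * q, by positivity, N + 2, fun d hd => ?_⟩
  obtain ⟨n, rfl⟩ : ∃ n, d = n + 1 := ⟨d - 1, by omega⟩
  obtain ⟨h1, h0⟩ := hRq (n + 1) (by omega)
  have hx : 0 < Rq (n + 1) - 1 := by linarith
  have hlog := gonchar_zero_log_eq hq hx n (by simpa using h0)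
  have hNn : (N : ℝ) ≤ n := by exact_mod_cast (by omega : N ≤ n)
  have hmain := gonchar_zero_abs_sub_le hq hx n
    (gonchar_zero_abs_log_le hq hx n (by omega) hlog) (by linarith) hlog
  have htwo : Rq (n + 1) - 1 - 1 = Rq (n + 1) - 2 := by ring
  rw [htwo] at hmain
  exact_mod_cast hmain
end

section
/- For every even integer d ≥ 2, the Gonchar polynomial G(d;z) = [(z−1)^d − z − 1]·z^{d−1} + (z−1)^d is self-reciprocal: z^{2d−1}·G(d;1/z) = G(d;z) for all z ≠ 0 (equivalently, the coefficients of z^k and z^{2d−1−k} in G(d;z) coincide for all 0 ≤ k ≤ 2d−1). Consequently, if ζ is a zero of G(d;z) then so is 1/ζ. -/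
/-- The Gonchar polynomial `G(d;z) = [(z−1)^d − z − 1]·z^{d−1} + (z−1)^d`
as a function `ℂ → ℂ`. -/
noncomputable def goncharFun (d : ℕ) (z : ℂ) : ℂ :=
  ((z - 1) ^ d - z - 1) * z ^ (d - 1) + (z - 1) ^ d

/-- For even `d ≥ 2` the Gonchar polynomial is self-reciprocal:
`z^{2d−1}·G(d;1/z) = G(d;z)` for all `z ≠ 0`; consequently if `ζ` is a zero of `G(d;·)`
then so is `1/ζ`. -/
theorem gonchar_self_reciprocal (d : ℕ) (hd : 2 ≤ d) (hde : Even d) :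
    (∀ z : ℂ, z ≠ 0 → z ^ (2 * d - 1) * goncharFun d (1 / z) = goncharFun d z) ∧
    (∀ ζ : ℂ, goncharFun d ζ = 0 → goncharFun d (1 / ζ) = 0) := by
  have recip : ∀ z : ℂ, z ≠ 0 →
      z ^ (2 * d - 1) * goncharFun d (1 / z) = goncharFun d z := by
    intro z hz
    obtain ⟨e, rfl⟩ : ∃ e, d = e + 1 := ⟨d - 1, by omega⟩
    have hpow : (1 / z - 1) ^ (e + 1) = (z - 1) ^ (e + 1) / z ^ (e + 1) := by
      rw [← div_pow, ← hde.neg_pow]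
      congr 1
      field_simp
      ring
    have hexp : 2 * (e + 1) - 1 = 2 * e + 1 := by omega
    simp only [goncharFun, hexp, hpow, one_div_pow, add_tsub_cancel_right]
    field_simp
    ring
  refine ⟨recip, fun ζ hζ => ?_⟩
  rcases eq_or_ne ζ 0 with rfl | h0
  · simpa using hζ
  · have h := recip ζ h0
    rw [hζ] at h
    exact (mul_eq_zero.mp h).resolve_left (pow_ne_zero _ h0)
end

section
/- For every odd integer d ≥ 1, the Gonchar polynomial G(d;z) = [(z−1)^d − z − 1]·z^{d−1} + (z−1)^d satisfies G(d;z) + z^{2d−1}·G(d;1/z) = −2(z^d + z^{d−1}) for all z ≠ 0; equivalently, the coefficients of z^k and z^{2d−1−k} in G(d;z) sum to zero for all k except the innermost pair k = d−1, d, where each pair of coefficients sums to −2. -/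
/-- For odd `d ≥ 1` the Gonchar polynomial satisfies
`G(d;z) + z^{2d−1}·G(d;1/z) = −2(z^d + z^{d−1})` for all `z ≠ 0`. -/
theorem gonchar_anti_reciprocal (d : ℕ) (hd : 1 ≤ d) (hdo : Odd d) :
    ∀ z : ℂ, z ≠ 0 →
      goncharFun d z + z ^ (2 * d - 1) * goncharFun d (1 / z)
        = -2 * (z ^ d + z ^ (d - 1)) := by
  intro z hz
  obtain ⟨e, rfl⟩ : ∃ e, d = e + 1 := ⟨d - 1, by omega⟩
  have hpow : (1 / z - 1) ^ (e + 1) = -(z - 1) ^ (e + 1) / z ^ (e + 1) := by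
    rw [← hdo.neg_pow, ← div_pow]
    congr 1
    field_simp
    ring
  have hdeg : 2 * (e + 1) - 1 = e + (e + 1) := by omega
  simp only [goncharFun, hpow, hdeg, Nat.add_sub_cancel, pow_add z e (e + 1)]
  generalize (z - 1) ^ (e + 1) = w
  rw [one_div_pow, pow_succ]
  field_simp
  ring
end

section
/- For every integer d ≥ 1, the cyclotomic polynomial z² − z + 1 divides the Gonchar polynomial G(d;z) = [(z−1)^d − z − 1]·z^{d−1} + (z−1)^d (in ℤ[z]) if and only if 6 divides d. -/
open Polynomial

/-- The Gonchar polynomial `G(d;z) = [(z−1)^d − z − 1]·z^{d−1} + (z−1)^d` in `ℤ[z]`. -/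
noncomputable def goncharPoly (d : ℕ) : Polynomial ℤ :=
  ((X - 1) ^ d - X - 1) * X ^ (d - 1) + (X - 1) ^ d

/-- At a root of `z² − z + 1` we have `z − 1 = z²` and `z⁶ = 1`, which makes `G(d;z)` vanish
for positive multiples `d` of `6`. -/
theorem aeval_goncharPoly_eq_zero {R : Type*} [CommRing R] {x : R} (hx : x ^ 2 - x + 1 = 0)
    (q : ℕ) : aeval x (goncharPoly (6 * q + 6)) = 0 := by
  have h1 : x - 1 = x ^ 2 := by linear_combination -hx
  have h6 : x ^ 6 = 1 := by linear_combination (x ^ 4 + x ^ 3 - x - 1) * hx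
  have h12 : (x ^ 2) ^ 6 = 1 := by rw [← pow_mul, mul_comm, pow_mul, h6, one_pow]
  have hd : 6 * q + 6 - 1 = 6 * q + 5 := rfl
  simp only [goncharPoly, hd, map_add, map_sub, map_mul, map_pow, aeval_X, map_one, h1]
  simp only [pow_add _ (6 * q), pow_mul _ 6 q, h6, h12, one_pow]
  linear_combination -h6

/-- The element `4` is a root of `z² − z + 1` modulo `13`, and `G(d;4)` vanishes modulo `13`
only for multiples `d` of `6`. -/
theorem six_dvd_of_aeval_goncharPoly_eq_zero {d : ℕ} (hd : 1 ≤ d)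
    (h : aeval (4 : ZMod 13) (goncharPoly d) = 0) : 6 ∣ d := by
  obtain ⟨e, rfl⟩ := Nat.exists_eq_add_of_le' hd
  have h3 : (3 : ZMod 13) ^ 6 = 1 := by decide
  have h4 : (4 : ZMod 13) ^ 6 = 1 := by decide
  have h41 : (4 : ZMod 13) - 1 = 3 := by decide
  simp only [goncharPoly, Nat.add_sub_cancel, map_add, map_sub, map_mul, map_pow, aeval_X,
    map_one, h41, pow_succ _ e] at h
  rw [pow_eq_pow_mod e h3, pow_eq_pow_mod e h4] at h
  have key : ∀ r < 6, ((3 : ZMod 13) ^ r * 3 - 4 - 1) * 4 ^ r + 3 ^ r * 3 = 0 → r = 5 := by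
    decide
  have := key _ (Nat.mod_lt e (by norm_num)) h
  omega

/-- For every `d ≥ 1`, the cyclotomic polynomial `z² − z + 1` divides
the Gonchar polynomial `G(d;z)` in `ℤ[z]` if and only if `6` divides `d`. -/
theorem gonchar_div_cyclotomic_six (d : ℕ) (hd : 1 ≤ d) :
    (X ^ 2 - X + 1 : Polynomial ℤ) ∣ goncharPoly d ↔ 6 ∣ d := by
  constructor
  · rintro ⟨p, hp⟩
    refine six_dvd_of_aeval_goncharPoly_eq_zero hd ?_
    have h0 : (4 : ZMod 13) ^ 2 - 4 + 1 = 0 := by decide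
    simp [hp, h0]
  · rintro ⟨k, rfl⟩
    obtain ⟨q, rfl⟩ := Nat.exists_eq_add_of_le' (show 1 ≤ k by omega)
    rw [← AdjoinRoot.mk_eq_zero, ← AdjoinRoot.aeval_eq]
    refine aeval_goncharPoly_eq_zero ?_ q
    simpa only [map_add, map_sub, map_pow, map_one, AdjoinRoot.mk_X] using
      (AdjoinRoot.mk_self : AdjoinRoot.mk (X ^ 2 - X + 1 : Polynomial ℤ) _ = 0)
end

section
/- Let d ≥ 1 and consider the Gonchar polynomial G(d;z) = [(z−1)^d − z − 1]·z^{d−1} + (z−1)^d. If d is odd, then G(d;z) has precisely one real zero; it is simple and lies in the interval (2,3]. If d is even, then G(d;z) has exactly three real zeros: one equal to −1, one in the open interval (1/3, 1/2), and one in the open interval (2,3); all three are simple. -/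
/-- The Gonchar polynomial `G(d;z) = [(z−1)^d − z − 1]·z^{d−1} + (z−1)^d`
as a function `ℝ → ℝ`. -/
noncomputable def goncharFunR (d : ℕ) : ℝ → ℝ := fun z =>
  ((z - 1) ^ d - z - 1) * z ^ (d - 1) + (z - 1) ^ d

lemma goncharFunR_succ (n : ℕ) (z : ℝ) :
    goncharFunR (n + 1) z = (z - 1) ^ (n + 1) * (z ^ n + 1) - (z + 1) * z ^ n := by
  simp only [goncharFunR, Nat.add_sub_cancel]
  ring

lemma hasDerivAt_goncharFunR_succ (n : ℕ) (z : ℝ) :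
    HasDerivAt (goncharFunR (n + 1))
      ((n + 1) * (z - 1) ^ n * (z ^ n + 1) + (z - 1) ^ (n + 1) * (n * z ^ (n - 1))
        - (z ^ n + (z + 1) * (n * z ^ (n - 1)))) z := by
  rw [funext (goncharFunR_succ n)]
  have h₁ := ((hasDerivAt_id z).sub_const 1).pow (n + 1)
  have h₂ := (hasDerivAt_pow n z).add_const 1
  have h₃ := ((hasDerivAt_id z).add_const 1).mul (hasDerivAt_pow n z)
  refine ((h₁.mul h₂).sub h₃).congr_deriv ?_
  simp

lemma continuous_goncharFunR (d : ℕ) : Continuous (goncharFunR d) := by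
  unfold goncharFunR
  fun_prop

lemma deriv_goncharFunR_ne_zero_of_pos (n : ℕ) {z : ℝ} (hz : 0 < z)
    (h : goncharFunR (n + 1) z = 0) : deriv (goncharFunR (n + 1)) z ≠ 0 := by
  rw [(hasDerivAt_goncharFunR_succ n z).deriv]
  rw [goncharFunR_succ, pow_succ] at h
  rw [pow_succ]
  intro h'
  have hR : z * (n * z ^ (n - 1)) = n * z ^ n := by
    rcases n with _ | n
    · simp
    · simp only [Nat.add_sub_cancel]
      ring
  have hQ : 0 < z ^ n := by positivity
  have hpos : 0 < n * z ^ n * (z + 1) * (z * z ^ n + 1) + 2 * z * z ^ n * (z ^ n + 1) := by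
    positivity
  generalize (n : ℝ) * z ^ (n - 1) = R at *
  generalize z ^ n = Q at *
  generalize (z - 1) ^ n = P at *
  refine hpos.ne' ?_
  linear_combination z * (z - 1) * (Q + 1) * h'
    - ((n + 1) * z * (Q + 1) + n * Q * (z - 1)) * h
    - (z - 1) * (Q + 1) * (P * (z - 1) - (z + 1)) * hR

lemma goncharFunR_zero_unique_of_one_lt (n : ℕ) {x y : ℝ} (hx : 1 < x) (hy : 1 < y)
    (hgx : goncharFunR (n + 1) x = 0) (hgy : goncharFunR (n + 1) y = 0) : x = y := by
  have key (z : ℝ) (hz : 1 < z) (h : goncharFunR (n + 1) z = 0) :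
      (z - 1) ^ n + (1 - 1 / z) ^ n = 1 + 2 / (z - 1) := by
    have hz0 : z ≠ 0 := by positivity
    have hz1 : z - 1 ≠ 0 := by linarith
    rw [goncharFunR_succ] at h
    rw [show 1 - 1 / z = (z - 1) / z by field_simp, div_pow]
    field_simp
    linear_combination h
  wlog hxy : x < y generalizing x y
  · by_contra hne
    exact hne (this hy hx hgy hgx (lt_of_le_of_ne (not_lt.mp hxy) (Ne.symm hne))).symm
  have h₁ : (x - 1) ^ n ≤ (y - 1) ^ n := by
    have : 0 ≤ x - 1 := by linarith
    gcongr
  have h₂ : (1 - 1 / x) ^ n ≤ (1 - 1 / y) ^ n := by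
    have : 0 ≤ 1 - 1 / x := by
      rw [sub_nonneg, div_le_one (by linarith)]
      exact hx.le
    gcongr
  have h₃ : 2 / (y - 1) < 2 / (x - 1) := by
    have : 0 < x - 1 := by linarith
    gcongr
  linarith [key x hx hgx, key y hy hgy]

lemma goncharFunR_zero_unique_of_lt_one {n : ℕ} (hn : Even (n + 1)) {x y : ℝ}
    (hx0 : 0 < x) (hx : x < 1) (hy0 : 0 < y) (hy : y < 1)
    (hgx : goncharFunR (n + 1) x = 0) (hgy : goncharFunR (n + 1) y = 0) : x = y := by
  have key (z : ℝ) (hz : 0 < z) (h : goncharFunR (n + 1) z = 0) :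
      (1 - z) ^ (n + 1) * (1 + 1 / z ^ n) = 1 + z := by
    rw [goncharFunR_succ, ← hn.neg_pow, neg_sub] at h
    field_simp
    linear_combination h
  wlog hxy : x < y generalizing x y
  · by_contra hne
    exact hne (this hy0 hy hx0 hx hgy hgx
      (lt_of_le_of_ne (not_lt.mp hxy) (Ne.symm hne))).symm
  have h₁ : (1 - y) ^ (n + 1) * (1 + 1 / y ^ n) ≤ (1 - x) ^ (n + 1) * (1 + 1 / x ^ n) := by
    have : 0 ≤ 1 - y := by linarith
    have : 0 ≤ 1 - x := by linarith
    gcongr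
  linarith [key x hx0 hgx, key y hy0 hgy]

lemma goncharFunR_two_neg (n : ℕ) : goncharFunR (n + 1) 2 < 0 := by
  rw [goncharFunR_succ]
  have : (1 : ℝ) ≤ 2 ^ n := one_le_pow₀ (by norm_num)
  norm_num
  linarith

lemma goncharFunR_three_nonneg (n : ℕ) : 0 ≤ goncharFunR (n + 1) 3 := by
  rw [goncharFunR_succ, pow_succ]
  norm_num
  rcases n.eq_zero_or_pos with rfl | hn
  · norm_num
  · have h₂ : (2 : ℝ) ≤ 2 ^ n := le_self_pow₀ (by norm_num) hn.ne'
    have h₃ : (0 : ℝ) < 3 ^ n := by positivity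
    nlinarith

lemma goncharFunR_three_pos {n : ℕ} (hn : n ≠ 0) : 0 < goncharFunR (n + 1) 3 := by
  rw [goncharFunR_succ, pow_succ]
  have h₂ : (2 : ℝ) ≤ 2 ^ n := le_self_pow₀ (by norm_num) hn
  have h₃ : (0 : ℝ) < 3 ^ n := by positivity
  norm_num
  nlinarith

lemma goncharFunR_one_third_pos {n : ℕ} (hn : Even (n + 1)) :
    0 < goncharFunR (n + 1) (1 / 3) := by
  have hn0 : n ≠ 0 := by
    rintro rfl
    simp at hn
  rw [goncharFunR_succ, ← hn.neg_pow, show -((1 : ℝ) / 3 - 1) = 2 * (1 / 3) by norm_num,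
    mul_pow, pow_succ, pow_succ]
  have h₂ : (2 : ℝ) ≤ 2 ^ n := le_self_pow₀ (by norm_num) hn0
  have h₃ : (0 : ℝ) < (1 / 3) ^ n := by positivity
  generalize ((1 : ℝ) / 3) ^ n = a at *
  nlinarith [mul_pos h₃ h₃, mul_le_mul_of_nonneg_right h₂ h₃.le,
    mul_le_mul_of_nonneg_right h₂ (mul_pos h₃ h₃).le]

lemma goncharFunR_one_half_neg {n : ℕ} (hn : Even (n + 1)) :
    goncharFunR (n + 1) (1 / 2) < 0 := by
  rw [goncharFunR_succ, ← hn.neg_pow, show -((1 : ℝ) / 2 - 1) = 1 / 2 by norm_num, pow_succ]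
  have h₁ : (0 : ℝ) < (1 / 2) ^ n := by positivity
  have h₂ : ((1 : ℝ) / 2) ^ n ≤ 1 := pow_le_one₀ (by norm_num) (by norm_num)
  nlinarith

lemma one_lt_of_goncharFunR_eq_zero_of_odd {n : ℕ} (hn : Odd (n + 1)) {z : ℝ}
    (h : goncharFunR (n + 1) z = 0) : 1 < z := by
  have hne : Even n := by simpa [parity_simps] using hn
  rw [goncharFunR_succ] at h
  by_contra! hz
  have hQ : 0 ≤ z ^ n := hne.pow_nonneg z
  have hP : 0 ≤ (1 - z) ^ (n + 1) := pow_nonneg (by linarith) _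
  rw [← neg_sub 1 z, hn.neg_pow] at h
  rcases le_or_gt (-1) z with hz1 | hz1
  · have hPQ : 0 ≤ (1 - z) ^ (n + 1) * z ^ n := mul_nonneg hP hQ
    have hzQ : 0 ≤ (z + 1) * z ^ n := mul_nonneg (by linarith) hQ
    have hP0 : (1 - z) ^ (n + 1) = 0 := by linarith
    have hz' : z = 1 := by linarith [eq_zero_of_pow_eq_zero hP0]
    subst hz'
    norm_num at h
  · have h₁ : 1 - z ≤ (1 - z) ^ (n + 1) := le_self_pow₀ (by linarith) n.succ_ne_zero
    nlinarith [mul_le_mul_of_nonneg_right h₁ hQ]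

lemma goncharFunR_neg_one {n : ℕ} (hn : Even (n + 1)) : goncharFunR (n + 1) (-1) = 0 := by
  have hno : Odd n := by simpa [parity_simps] using hn
  simp [goncharFunR_succ, hno.neg_one_pow]

lemma deriv_goncharFunR_neg_one_ne_zero {n : ℕ} (hn : Even (n + 1)) :
    deriv (goncharFunR (n + 1)) (-1) ≠ 0 := by
  have hno : Odd n := by simpa [parity_simps] using hn
  have hne : Even (n - 1) := hno.tsub_odd odd_one
  rw [(hasDerivAt_goncharFunR_succ n (-1)).deriv, hno.neg_one_pow, hne.neg_one_pow]
  have : 0 ≤ ((-1 : ℝ) - 1) ^ (n + 1) := hn.pow_nonneg _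
  have := mul_nonneg this n.cast_nonneg
  refine ne_of_gt ?_
  linarith

lemma eq_neg_one_of_goncharFunR_eq_zero {n : ℕ} (hn : Even (n + 1)) {z : ℝ} (hz : z ≤ 0)
    (h : goncharFunR (n + 1) z = 0) : z = -1 := by
  have hno : Odd n := by simpa [parity_simps] using hn
  rw [goncharFunR_succ] at h
  obtain ⟨x, rfl⟩ : ∃ x, z = -x := ⟨-z, by ring⟩
  have hx : 0 ≤ x := by linarith
  rw [hno.neg_pow, ← hn.neg_pow] at h
  have hP : 0 < (-(-x - 1)) ^ (n + 1) := pow_pos (by linarith) _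
  have hQ : 0 ≤ x ^ n := pow_nonneg hx n
  rcases lt_trichotomy x 1 with hx1 | rfl | hx1
  · have : x ^ n < 1 := pow_lt_one₀ hx hx1 hno.pos.ne'
    nlinarith [mul_pos hP (sub_pos.mpr this)]
  · rfl
  · have : 1 < x ^ n := one_lt_pow₀ hx1 hno.pos.ne'
    nlinarith [mul_pos hP (sub_pos.mpr this)]

/-- If `d` is odd, `G(d;z)` has precisely one real zero; it is simple and
lies in `(2,3]`. If `d` is even, `G(d;z)` has exactly three real zeros: `−1`, one in
`(1/3,1/2)` and one in `(2,3)`; all simple. -/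
theorem gonchar_real_zeros (d : ℕ) (hd : 1 ≤ d) :
    (Odd d → ∃ z : ℝ, (2 < z ∧ z ≤ 3) ∧ goncharFunR d z = 0 ∧
      deriv (goncharFunR d) z ≠ 0 ∧ ∀ w : ℝ, goncharFunR d w = 0 → w = z) ∧
    (Even d → ∃ z₁ z₂ : ℝ, (1 / 3 < z₁ ∧ z₁ < 1 / 2) ∧ (2 < z₂ ∧ z₂ < 3) ∧
      goncharFunR d (-1) = 0 ∧ goncharFunR d z₁ = 0 ∧ goncharFunR d z₂ = 0 ∧
      deriv (goncharFunR d) (-1) ≠ 0 ∧ deriv (goncharFunR d) z₁ ≠ 0 ∧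
      deriv (goncharFunR d) z₂ ≠ 0 ∧
      ∀ w : ℝ, goncharFunR d w = 0 → w = -1 ∨ w = z₁ ∨ w = z₂) := by
  obtain ⟨n, rfl⟩ : ∃ n, d = n + 1 := ⟨d - 1, by omega⟩
  have hc (s : Set ℝ) : ContinuousOn (goncharFunR (n + 1)) s :=
    (continuous_goncharFunR (n + 1)).continuousOn
  constructor
  · intro hodd
    obtain ⟨z, hz, hgz⟩ := intermediate_value_Ioc (by norm_num) (hc (Set.Icc 2 3))
      ⟨goncharFunR_two_neg n, goncharFunR_three_nonneg n⟩
    have hz2 : 2 < z := hz.1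
    exact ⟨z, hz, hgz, deriv_goncharFunR_ne_zero_of_pos n (by linarith) hgz, fun w hw =>
      goncharFunR_zero_unique_of_one_lt n (one_lt_of_goncharFunR_eq_zero_of_odd hodd hw)
        (by linarith) hw hgz⟩
  · intro heven
    have hn : n ≠ 0 := by
      rintro rfl
      simp at heven
    obtain ⟨z₁, hz₁, hg₁⟩ := intermediate_value_Ioo' (by norm_num) (hc (Set.Icc (1 / 3) (1 / 2)))
      ⟨goncharFunR_one_half_neg heven, goncharFunR_one_third_pos heven⟩
    obtain ⟨z₂, hz₂, hg₂⟩ := intermediate_value_Ioo (by norm_num) (hc (Set.Icc 2 3))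
      ⟨goncharFunR_two_neg n, goncharFunR_three_pos hn⟩
    have h₁ : 1 / 3 < z₁ := hz₁.1
    have h₁' : z₁ < 1 / 2 := hz₁.2
    have h₂ : 2 < z₂ := hz₂.1
    refine ⟨z₁, z₂, hz₁, hz₂, goncharFunR_neg_one heven, hg₁, hg₂,
      deriv_goncharFunR_neg_one_ne_zero heven,
      deriv_goncharFunR_ne_zero_of_pos n (by linarith) hg₁,
      deriv_goncharFunR_ne_zero_of_pos n (by linarith) hg₂, fun w hw => ?_⟩
    rcases le_or_gt w 0 with hw0 | hw0
    · exact Or.inl (eq_neg_one_of_goncharFunR_eq_zero heven hw0 hw)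
    rcases lt_trichotomy w 1 with hw1 | rfl | hw1
    · exact Or.inr (Or.inl (goncharFunR_zero_unique_of_lt_one heven hw0 hw1 (by linarith)
        (by linarith) hw hg₁))
    · norm_num [goncharFunR_succ] at hw
    · exact Or.inr (Or.inr (goncharFunR_zero_unique_of_one_lt n hw1 (by linarith) hw hg₂))
end

section
/- For each integer d ≥ 1 let ξ(d) denote the unique real zero in the interval (2,3] of the Gonchar polynomial G(d;z) = [(z−1)^d − z − 1]·z^{d−1} + (z−1)^d. Then the sequence (ξ(d))_{d≥1} is strictly monotonically decreasing and converges to 2 as d → ∞. -/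
/-- The Gonchar polynomial of index `n + 1` at `x + 1`, divided by `x * (x + 1) ^ n`. -/
noncomputable def goncharReduced (n : ℕ) (x : ℝ) : ℝ :=
  x ^ n + (x / (x + 1)) ^ n - 1 - 2 / x

theorem goncharFunR_succ_eq_mul_goncharReduced (n : ℕ) {x : ℝ} (hx : 0 < x) :
    goncharFunR (n + 1) (x + 1) = x * (x + 1) ^ n * goncharReduced n x := by
  have h : x + 1 ≠ 0 := by positivity
  simp only [goncharFunR, goncharReduced, div_pow, Nat.add_sub_cancel, add_sub_cancel_right]
  field_simp
  ring

theorem goncharReduced_monotone (n : ℕ) {x y : ℝ} (hx : 0 < x) (hxy : x ≤ y) :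
    goncharReduced n x ≤ goncharReduced n y := by
  have hy : 0 < y := hx.trans_le hxy
  have h1 : x ^ n ≤ y ^ n := by gcongr
  have h2 : x / (x + 1) ≤ y / (y + 1) := by
    rw [div_le_div_iff₀ (by positivity) (by positivity)]
    linarith
  have h3 : (x / (x + 1)) ^ n ≤ (y / (y + 1)) ^ n := by gcongr
  have h4 : 2 / y ≤ 2 / x := by gcongr
  unfold goncharReduced
  linarith

theorem goncharReduced_succ_sub (n : ℕ) {x : ℝ} (hx : 0 < x) :
    goncharReduced (n + 1) x - goncharReduced n x =
      x ^ n / (x + 1) ^ (n + 1) * ((x - 1) * (x + 1) ^ (n + 1) - 1) := by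
  have h : x + 1 ≠ 0 := by positivity
  simp only [goncharReduced, div_pow]
  field_simp
  ring

theorem two_le_pow_succ_of_goncharReduced_eq_zero {n : ℕ} {x : ℝ} (hx : 0 < x)
    (h : goncharReduced n x = 0) : 2 ≤ x ^ (n + 1) := by
  have hr : (x / (x + 1)) ^ n ≤ 1 :=
    pow_le_one₀ (by positivity) (by rw [div_le_one (by positivity)]; linarith)
  have hd : 2 / x ≤ x ^ n := by
    unfold goncharReduced at h
    linarith
  rw [pow_succ]
  exact (div_le_iff₀ hx).mp hd

theorem one_lt_mul_pow_of_two_le_pow {m : ℕ} (hm : 1 ≤ m) {x : ℝ} (hx : 1 < x)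
    (h : 2 ≤ x ^ m) : 1 < (x - 1) * (x + 1) ^ m := by
  have h0 : 0 < x := by linarith
  have hbern : 1 + (m : ℝ) * (x⁻¹ - 1) ≤ x⁻¹ ^ m := by
    have := one_add_mul_le_pow (a := x⁻¹ - 1) (by linarith [inv_pos.mpr h0]) m
    simpa using this
  have hinv : x⁻¹ ^ m ≤ 1 / 2 := by
    rw [inv_pow, one_div]
    exact inv_anti₀ two_pos h
  have hsub : 1 - x⁻¹ ≤ x - 1 := by
    have := Real.one_sub_inv_le_log_of_pos h0
    have := Real.log_le_sub_one_of_pos h0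
    linarith
  have hm0 : (1 : ℝ) ≤ m := by exact_mod_cast hm
  have hlin : 1 ≤ (x - 1) * (2 * m) := by nlinarith
  have hnat : 2 * m ≤ 2 ^ m := by
    obtain ⟨k, rfl⟩ := Nat.exists_eq_add_of_le' hm
    have := Nat.lt_two_pow_self (n := k)
    rw [pow_succ]
    omega
  have hcast : (2 * m : ℝ) ≤ 2 ^ m := by exact_mod_cast hnat
  have hpow : (2 : ℝ) ^ m < (x + 1) ^ m :=
    pow_lt_pow_left₀ (by linarith) two_pos.le (by omega)
  nlinarith

theorem goncharFunR_zero_succ_lt {n : ℕ} {z w : ℝ} (hz : 2 < z) (hw : 2 < w)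
    (hGz : goncharFunR (n + 1) z = 0) (hGw : goncharFunR (n + 2) w = 0) : w < z := by
  have reduce : ∀ (k : ℕ) (u : ℝ), 2 < u → goncharFunR (k + 1) u = 0 →
      goncharReduced k (u - 1) = 0 := by
    intro k u hu hG
    have hu0 : 0 < u - 1 := by linarith
    have hmul := goncharFunR_succ_eq_mul_goncharReduced k hu0
    rw [sub_add_cancel, hG] at hmul
    exact (mul_eq_zero.mp hmul.symm).resolve_left (by positivity)
  have hz0 : 0 < z - 1 := by linarith
  have hrz := reduce n z hz hGz
  have hrw := reduce (n + 1) w hw hGw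
  have hgrow := one_lt_mul_pow_of_two_le_pow (m := n + 1) (by omega)
    (by linarith : 1 < z - 1) (two_le_pow_succ_of_goncharReduced_eq_zero hz0 hrz)
  have hpos : 0 < goncharReduced (n + 1) (z - 1) := by
    have hstep := goncharReduced_succ_sub n hz0
    rw [hrz, sub_zero] at hstep
    rw [hstep]
    exact mul_pos (by positivity) (by linarith)
  by_contra! hle
  have := goncharReduced_monotone (n + 1) hz0 (by linarith : z - 1 ≤ w - 1)
  linarith

theorem goncharFunR_zero_le {d : ℕ} (hd : 1 ≤ d) {z : ℝ} (hz : 2 < z) (hz3 : z ≤ 3)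
    (hG : goncharFunR d z = 0) : z ≤ 2 + 3 / d := by
  have hd0 : (0 : ℝ) < d := by exact_mod_cast hd
  have hpow : (z - 1) ^ d ≤ 4 := by
    by_contra! hlt
    have hprod : 0 < ((z - 1) ^ d - z - 1) * z ^ (d - 1) :=
      mul_pos (by linarith) (by positivity)
    unfold goncharFunR at hG
    linarith
  have hbern := one_add_mul_le_pow (a := z - 2) (by linarith) d
  rw [show 1 + (z - 2) = z - 1 by ring] at hbern
  have : z - 2 ≤ 3 / d := by
    rw [le_div_iff₀ hd0]
    linarith
  linarith

/-- For each `d ≥ 1` let `ξ(d)` be the unique real zero of `G(d;z)` in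
`(2,3]`. Then the sequence `(ξ(d))` is strictly decreasing and converges to `2`. -/
theorem gonchar_zero_decreasing (ξ : ℕ → ℝ)
    (hξ : ∀ d : ℕ, 1 ≤ d → (2 < ξ d ∧ ξ d ≤ 3) ∧ goncharFunR d (ξ d) = 0) :
    (∀ d₁ d₂ : ℕ, 1 ≤ d₁ → d₁ < d₂ → ξ d₂ < ξ d₁) ∧
    Filter.Tendsto ξ Filter.atTop (nhds 2) := by
  constructor
  · intro d₁ d₂ h1 h12
    induction d₂, h12 using Nat.le_induction with
    | base =>
      obtain ⟨n, rfl⟩ := Nat.exists_eq_add_of_le' h1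
      exact goncharFunR_zero_succ_lt (hξ (n + 1) h1).1.1 (hξ (n + 2) (by omega)).1.1
        (hξ (n + 1) h1).2 (hξ (n + 2) (by omega)).2
    | succ m hm ih =>
      obtain ⟨n, rfl⟩ := Nat.exists_eq_add_of_le' (show 1 ≤ m by omega)
      exact (goncharFunR_zero_succ_lt (hξ (n + 1) (by omega)).1.1 (hξ (n + 2) (by omega)).1.1
        (hξ (n + 1) (by omega)).2 (hξ (n + 2) (by omega)).2).trans ih
  · have hlim : Filter.Tendsto (fun d : ℕ => 2 + 3 / (d : ℝ)) Filter.atTop (nhds 2) := by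
      simpa using (tendsto_const_div_atTop_nhds_zero_nat (3 : ℝ)).const_add 2
    refine tendsto_of_tendsto_of_tendsto_of_le_of_le' tendsto_const_nhds hlim ?_ ?_
    · filter_upwards [Filter.eventually_ge_atTop 1] with d hd
      exact (hξ d hd).1.1.le
    · filter_upwards [Filter.eventually_ge_atTop 1] with d hd
      exact goncharFunR_zero_le hd (hξ d hd).1.1 (hξ d hd).1.2 (hξ d hd).2
end

section
/- Let d ≥ 2 and let z₁ ≠ z₂ be two points in ℝ^{d+1}. Then ∫_{ℝ^{d+1}} 1/(‖t−z₁‖^d · ‖t−z₂‖^d) dt = C_d / ‖z₁−z₂‖^{d−1}, where the integral is with respect to (d+1)-dimensional Lebesgue measure and C_d = π^{(d+3)/2} · Γ((d−1)/2) / [Γ(d/2)]². -/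
open MeasureTheory

section RieszKernel

open Real Set

theorem lintegral_ofReal_of_integral_eq {α : Type*} [MeasurableSpace α] {μ : Measure α}
    {f : α → ℝ} {v : ℝ} (hf : 0 ≤ᵐ[μ] f) (h : ∫ x, f x ∂μ = v) (hv : v ≠ 0) :
    ∫⁻ x, ENNReal.ofReal (f x) ∂μ = ENNReal.ofReal v := by
  rw [← h] at hv ⊢
  exact (ofReal_integral_eq_lintegral_ofReal (.of_integral_ne_zero hv) hf).symm

theorem lintegral_pow_mul_exp_neg_sq (m : ℕ) {c : ℝ} (hc : 0 < c) :
    ∫⁻ s in Ioi (0 : ℝ), ENNReal.ofReal (s ^ m * exp (-(c * s) ^ 2)) =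
      ENNReal.ofReal ((c ^ (m + 1))⁻¹ * (Gamma (((m : ℝ) + 1) / 2) / 2)) := by
  have hG : 0 < Gamma (((m : ℝ) + 1) / 2) := Gamma_pos_of_pos (by positivity)
  refine lintegral_ofReal_of_integral_eq ?_ ?_ (by positivity)
  · filter_upwards [ae_restrict_mem measurableSet_Ioi] with s hs
    have : 0 < s := hs
    simp only [Pi.zero_apply]
    positivity
  · have h := integral_rpow_mul_exp_neg_mul_rpow (p := 2) (q := m) (b := c ^ 2) two_pos
      (by linarith [m.cast_nonneg (α := ℝ)]) (by positivity)
    have hpow : (c ^ 2) ^ (-((m : ℝ) + 1) / 2) = (c ^ (m + 1))⁻¹ := by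
      rw [← rpow_natCast c 2, ← rpow_mul hc.le, ← rpow_natCast c (m + 1), ← rpow_neg hc.le]
      congr 1
      push_cast
      ring
    rw [hpow] at h
    calc _ = _ := by
          refine setIntegral_congr_fun measurableSet_Ioi fun s _ => ?_
          simp only [rpow_natCast, rpow_two]
          ring_nf
      _ = _ := h
      _ = _ := by ring

section Gaussian

universe u

variable {V : Type u} [NormedAddCommGroup V]

/-- The Gaussian mixture density whose integral over the positive scales `s` and `w` is, up to a
constant, the product `‖t - x‖ ^ (-(k + 2)) * ‖t - y‖ ^ (-(k + 2))`. -/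
noncomputable def rieszMixture (k : ℕ) (x y t : V) (s w : ℝ) : ℝ :=
  s ^ (2 * k + 3) * w ^ (k + 1) * exp (-(s ^ 2 * (‖t - x‖ ^ 2 + w ^ 2 * ‖t - y‖ ^ 2)))

theorem lintegral_lintegral_rieszMixture (k : ℕ) {x y t : V} (hx : t ≠ x) (hy : t ≠ y) :
    ∫⁻ s in Ioi (0 : ℝ), ∫⁻ w in Ioi (0 : ℝ), ENNReal.ofReal (rieszMixture k x y t s w) =
      ENNReal.ofReal ((Gamma (((k : ℝ) + 2) / 2) / 2) ^ 2) *
        ENNReal.ofReal (1 / (‖t - x‖ ^ (k + 2) * ‖t - y‖ ^ (k + 2))) := by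
  have hA : 0 < ‖t - x‖ := norm_pos_iff.2 (sub_ne_zero.2 hx)
  have hB : 0 < ‖t - y‖ := norm_pos_iff.2 (sub_ne_zero.2 hy)
  have hG : 0 < Gamma (((k : ℝ) + 2) / 2) := Gamma_pos_of_pos (by positivity)
  have hcast : (((k + 1 : ℕ) : ℝ) + 1) / 2 = ((k : ℝ) + 2) / 2 := by push_cast; ring
  have inner : ∀ s ∈ Ioi (0 : ℝ),
      ∫⁻ w in Ioi (0 : ℝ), ENNReal.ofReal (rieszMixture k x y t s w) =
        ENNReal.ofReal ((‖t - y‖ ^ (k + 2))⁻¹ * (Gamma (((k : ℝ) + 2) / 2) / 2)) *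
          ENNReal.ofReal (s ^ (k + 1) * exp (-(‖t - x‖ * s) ^ 2)) := by
    intro s hs
    have hs : 0 < s := hs
    have h := lintegral_pow_mul_exp_neg_sq (k + 1) (mul_pos hs hB)
    rw [hcast] at h
    calc _ = ∫⁻ w in Ioi (0 : ℝ), ENNReal.ofReal (s ^ (2 * k + 3) * exp (-(‖t - x‖ * s) ^ 2)) *
          ENNReal.ofReal (w ^ (k + 1) * exp (-(s * ‖t - y‖ * w) ^ 2)) := by
          refine lintegral_congr fun w => ?_
          rw [← ENNReal.ofReal_mul (by positivity), rieszMixture,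
            mul_mul_mul_comm, ← exp_add]
          congr 3
          ring
      _ = _ := by
          rw [lintegral_const_mul' _ _ ENNReal.ofReal_ne_top, h,
            ← ENNReal.ofReal_mul (by positivity), ← ENNReal.ofReal_mul (by positivity)]
          congr 1
          field_simp
          ring
  have h := lintegral_pow_mul_exp_neg_sq (k + 1) hA
  rw [hcast] at h
  rw [setLIntegral_congr_fun measurableSet_Ioi inner,
    lintegral_const_mul' _ _ ENNReal.ofReal_ne_top, h, ← ENNReal.ofReal_mul (by positivity),
    ← ENNReal.ofReal_mul (by positivity)]
  congr 1
  field_simp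

variable [InnerProductSpace ℝ V]

theorem norm_sub_sq_add_mul_norm_sub_sq (t x y : V) {u : ℝ} (hu : 0 ≤ u) :
    ‖t - x‖ ^ 2 + u * ‖t - y‖ ^ 2 =
      (1 + u) * ‖t - (1 + u)⁻¹ • (x + u • y)‖ ^ 2 + u / (1 + u) * ‖x - y‖ ^ 2 := by
  have hu' : 1 + u ≠ 0 := by positivity
  simp only [norm_sub_sq_real, norm_smul, inner_smul_right, inner_add_right, mul_pow,
    norm_add_sq_real, norm_eq_abs, sq_abs]
  field_simp
  ring

variable [FiniteDimensional ℝ V] [MeasurableSpace V] [BorelSpace V]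

theorem lintegral_exp_neg_sq_mul_norm_sub_sq (p : V) {b : ℝ} (hb : 0 < b) :
    ∫⁻ t : V, ENNReal.ofReal (exp (-(b ^ 2 * ‖t - p‖ ^ 2))) =
      ENNReal.ofReal ((√π / b) ^ Module.finrank ℝ V) := by
  rw [lintegral_sub_right_eq_self (fun t : V => ENNReal.ofReal (exp (-(b ^ 2 * ‖t‖ ^ 2)))) p]
  refine lintegral_ofReal_of_integral_eq (.of_forall fun _ => (exp_pos _).le) ?_
    (by positivity)
  have h := GaussianFourier.integral_rexp_neg_mul_sq_norm (V := V) (b := b ^ 2) (by positivity)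
  simp only [neg_mul] at h
  rw [h, div_eq_inv_mul (Module.finrank ℝ V : ℝ), ← one_div, rpow_mul (by positivity),
    ← sqrt_eq_rpow, rpow_natCast, sqrt_div pi_nonneg, sqrt_sq hb.le]

theorem lintegral_rieszMixture (k : ℕ) (x y : V) (hV : Module.finrank ℝ V = k + 3) {s w : ℝ}
    (hs : 0 < s) (hw : 0 < w) :
    ∫⁻ t : V, ENNReal.ofReal (rieszMixture k x y t s w) =
      ENNReal.ofReal (w ^ (k + 1) * (√π / √(1 + w ^ 2)) ^ (k + 3)) *
        ENNReal.ofReal (s ^ k * exp (-(w / √(1 + w ^ 2) * ‖x - y‖ * s) ^ 2)) := by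
  have hq : √(1 + w ^ 2) ^ 2 = 1 + w ^ 2 := sq_sqrt (by positivity)
  have hq0 : 0 < √(1 + w ^ 2) := sqrt_pos.2 (by positivity)
  have h := lintegral_exp_neg_sq_mul_norm_sub_sq ((1 + w ^ 2)⁻¹ • (x + w ^ 2 • y))
    (mul_pos hs hq0)
  rw [hV] at h
  calc _ = ∫⁻ t : V, ENNReal.ofReal (s ^ (2 * k + 3) * w ^ (k + 1) *
          exp (-(w / √(1 + w ^ 2) * ‖x - y‖ * s) ^ 2)) *
        ENNReal.ofReal (exp (-((s * √(1 + w ^ 2)) ^ 2 *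
          ‖t - (1 + w ^ 2)⁻¹ • (x + w ^ 2 • y)‖ ^ 2))) := by
        refine lintegral_congr fun t => ?_
        rw [← ENNReal.ofReal_mul (by positivity), rieszMixture, mul_assoc _ (exp _), ← exp_add,
          norm_sub_sq_add_mul_norm_sub_sq t x y (sq_nonneg w)]
        congr 3
        simp only [mul_pow, div_pow, hq]
        ring
    _ = _ := by
        rw [lintegral_const_mul' _ _ ENNReal.ofReal_ne_top, h,
          ← ENNReal.ofReal_mul (by positivity), ← ENNReal.ofReal_mul (by positivity)]
        congr 1
        simp only [div_pow, mul_pow]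
        field_simp
        ring

theorem lintegral_lintegral_rieszMixture_of_pos (k : ℕ) {x y : V} (hxy : x ≠ y)
    (hV : Module.finrank ℝ V = k + 3) {w : ℝ} (hw : 0 < w) :
    ∫⁻ s in Ioi (0 : ℝ), ∫⁻ t : V, ENNReal.ofReal (rieszMixture k x y t s w) =
      ENNReal.ofReal (√π ^ (k + 3) * (Gamma (((k : ℝ) + 1) / 2) / 2) / ‖x - y‖ ^ (k + 1)) *
        ENNReal.ofReal (1 + w ^ 2)⁻¹ := by
  have hr : 0 < ‖x - y‖ := norm_pos_iff.2 (sub_ne_zero.2 hxy)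
  have hG : 0 < Gamma (((k : ℝ) + 1) / 2) := Gamma_pos_of_pos (by positivity)
  have hq : √(1 + w ^ 2) ^ 2 = 1 + w ^ 2 := sq_sqrt (by positivity)
  have hq0 : 0 < √(1 + w ^ 2) := sqrt_pos.2 (by positivity)
  rw [setLIntegral_congr_fun measurableSet_Ioi fun s hs =>
      lintegral_rieszMixture k x y hV hs hw,
    lintegral_const_mul' _ _ ENNReal.ofReal_ne_top,
    lintegral_pow_mul_exp_neg_sq k (by positivity), ← ENNReal.ofReal_mul (by positivity),
    ← ENNReal.ofReal_mul (by positivity)]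
  congr 1
  rw [← hq]
  simp only [div_pow, mul_pow, sqrt_sq hq0.le]
  field_simp
  ring

theorem lintegral_Ioi_inv_one_add_sq :
    ∫⁻ w in Ioi (0 : ℝ), ENNReal.ofReal (1 + w ^ 2)⁻¹ = ENNReal.ofReal (π / 2) :=
  lintegral_ofReal_of_integral_eq (.of_forall fun w => by simp only [Pi.zero_apply]; positivity)
    (by simp) (by positivity)

theorem lintegral_rieszMixture_comm (k : ℕ) (x y : V) :
    ∫⁻ t : V, ∫⁻ s in Ioi (0 : ℝ), ∫⁻ w in Ioi (0 : ℝ),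
        ENNReal.ofReal (rieszMixture k x y t s w) =
      ∫⁻ w in Ioi (0 : ℝ), ∫⁻ s in Ioi (0 : ℝ), ∫⁻ t : V,
        ENNReal.ofReal (rieszMixture k x y t s w) := by
  have hm {β : Type u} [MeasurableSpace β] {f : β → V} {g h : β → ℝ} (hf : Measurable f)
      (hg : Measurable g) (hh : Measurable h) :
      Measurable fun b => ENNReal.ofReal (rieszMixture k x y (f b) (g b) (h b)) := by
    unfold rieszMixture
    fun_prop
  rw [lintegral_lintegral_swap]
  · rw [lintegral_congr fun s => lintegral_lintegral_swap
      (hm (f := Prod.fst) (g := fun _ => s) (h := Prod.snd)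
        measurable_fst measurable_const measurable_snd).aemeasurable]
    rw [lintegral_lintegral_swap]
    exact (Measurable.lintegral_prod_right' (f := fun z : (ℝ × ℝ) × V =>
      ENNReal.ofReal (rieszMixture k x y z.2 z.1.1 z.1.2))
      (hm (by fun_prop) (by fun_prop) (by fun_prop))).aemeasurable
  · exact (Measurable.lintegral_prod_right' (f := fun z : (V × ℝ) × ℝ =>
      ENNReal.ofReal (rieszMixture k x y z.1.1 z.1.2 z.2))
      (hm (by fun_prop) (by fun_prop) (by fun_prop))).aemeasurable

theorem lintegral_riesz_kernel_mul (k : ℕ) {x y : V} (hxy : x ≠ y)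
    (hV : Module.finrank ℝ V = k + 3) :
    ENNReal.ofReal ((Gamma (((k : ℝ) + 2) / 2) / 2) ^ 2) *
        ∫⁻ t : V, ENNReal.ofReal (1 / (‖t - x‖ ^ (k + 2) * ‖t - y‖ ^ (k + 2))) =
      ENNReal.ofReal (√π ^ (k + 3) * (Gamma (((k : ℝ) + 1) / 2) / 2) / ‖x - y‖ ^ (k + 1)) *
        ENNReal.ofReal (π / 2) := by
  have : Nontrivial V := Module.nontrivial_of_finrank_pos (R := ℝ) (by omega)
  rw [← lintegral_Ioi_inv_one_add_sq, ← lintegral_const_mul' _ _ ENNReal.ofReal_ne_top,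
    ← lintegral_const_mul' _ _ ENNReal.ofReal_ne_top,
    ← setLIntegral_congr_fun measurableSet_Ioi fun w hw =>
      lintegral_lintegral_rieszMixture_of_pos k hxy hV hw,
    ← lintegral_rieszMixture_comm]
  refine lintegral_congr_ae ?_
  filter_upwards [Measure.ae_ne volume x, Measure.ae_ne volume y] with t hx hy
  exact (lintegral_lintegral_rieszMixture k hx hy).symm

end Gaussian

end RieszKernel

/-- For `d ≥ 2` and distinct points `z₁ ≠ z₂` in `ℝ^{d+1}`,
`∫_{ℝ^{d+1}} ‖t−z₁‖^{−d}·‖t−z₂‖^{−d} dt = C_d/‖z₁−z₂‖^{d−1}` with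
`C_d = π^{(d+3)/2}·Γ((d−1)/2)/Γ(d/2)²`. -/
theorem riesz_kernel_convolution (d : ℕ) (hd : 2 ≤ d)
    (z₁ z₂ : EuclideanSpace ℝ (Fin (d + 1))) (hz : z₁ ≠ z₂) :
    ∫ t : EuclideanSpace ℝ (Fin (d + 1)), 1 / (‖t - z₁‖ ^ d * ‖t - z₂‖ ^ d)
      = (Real.pi ^ (((d : ℝ) + 3) / 2) * Real.Gamma (((d : ℝ) - 1) / 2)
          / (Real.Gamma ((d : ℝ) / 2)) ^ 2) / ‖z₁ - z₂‖ ^ (d - 1) := by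
  obtain ⟨k, rfl⟩ := Nat.exists_eq_add_of_le' hd
  have h := congrArg ENNReal.toReal (lintegral_riesz_kernel_mul k hz (by simp))
  have hG : 0 < Real.Gamma (((k : ℝ) + 2) / 2) := Real.Gamma_pos_of_pos (by positivity)
  have hG' : 0 < Real.Gamma (((k : ℝ) + 1) / 2) := Real.Gamma_pos_of_pos (by positivity)
  have hr : 0 < ‖z₁ - z₂‖ := norm_pos_iff.2 (sub_ne_zero.2 hz)
  rw [integral_eq_lintegral_of_nonneg_ae (.of_forall fun t => by positivity)
    (Measurable.aestronglyMeasurable (by fun_prop))]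
  rw [ENNReal.toReal_mul, ENNReal.toReal_mul, ENNReal.toReal_ofReal (by positivity),
    ENNReal.toReal_ofReal (by positivity), ENNReal.toReal_ofReal (by positivity)] at h
  have hpi : Real.pi ^ (((k : ℝ) + 2 + 3) / 2) = √Real.pi ^ (k + 3) * Real.pi := by
    rw [Real.sqrt_eq_rpow, ← Real.rpow_natCast, ← Real.rpow_mul Real.pi_nonneg,
      ← Real.rpow_add_one Real.pi_ne_zero]
    congr 1
    push_cast
    ring
  push_cast
  rw [hpi, show (k : ℝ) + 2 - 1 = k + 1 by ring]
  field_simp at h ⊢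
  linarith
end
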